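/- Combinatorial identity underlying the equality of Springer representations for types $C_n$ and $B_n$ (3.6(a)): For any partition $p_1 \ge \dots \ge p_\sigma \ge 1$ of $n$ with conjugate $\bar p$ and $k = p_1$, and writing $\bar p_1 = a + b$ with $b - a \in \{0,1\}$, the symbol $j_{S_{\bar p_k} \times \dots \times S_{\bar p_2} \times S_{\bar p_1}}^{W_n}(\mathrm{sgn})$ equals the symbol $j_{S_{\bar p_k} \times \dots \times S_{\bar p_2} \times W_a \times W'_b}^{W_n}(\mathrm{sgn})$; i.e., the two $j$-inductions into $W_n$ produce the same irreducible representation of $W_n$. -/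

import Mathlib

open Finset Equiv

namespace CS

noncomputable section

/-- Inner product of class functions on a finite group. -/
def cinner {G : Type} [Group G] (φ ψ : G → ℂ) : ℂ :=
  (Nat.card G : ℂ)⁻¹ * ∑ᶠ g : G, φ g * ψ g⁻¹

/-- The character of the `d`-th symmetric power of a representation with character
`χ`, computed via Newton's recursion
`d·χ_{Sym^d}(g) = ∑_{k=1}^{d} χ(g^k) χ_{Sym^{d-k}}(g)`. -/
def symChar {G : Type} [Group G] (χ : G → ℂ) : ℕ → G → ℂ
  | 0, _ => 1
  | (d+1), g => ((d : ℂ) + 1)⁻¹ *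
      ∑ k ∈ Finset.range (d + 1), χ (g ^ (k + 1)) * symChar χ (d - k) g
  termination_by d _ => d
  decreasing_by omega

/-- Induction of class functions from a subgroup `H` to a subgroup `K` (of an ambient
group `G`), by the usual induced-character formula. -/
def indChar {G : Type} [Group G] (H K : Subgroup G) (φ : H → ℂ) : K → ℂ :=
  open scoped Classical in
  fun g => (Nat.card H : ℂ)⁻¹ *
    ∑ᶠ x : K, if h : ((x : G) * g * (x : G)⁻¹) ∈ H then φ ⟨_, h⟩ else 0

/-- Restriction of a class function on the ambient group to a subgroup. -/
def resChar {G : Type} [Group G] (H : Subgroup G) (χ : G → ℂ) : H → ℂ :=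
  fun h => χ h

/-- Restriction of a class function from a subgroup `K` to a subgroup `H` (junk value
`0` off `K`; meaningful when `H ≤ K`). -/
def resSub {G : Type} [Group G] (H K : Subgroup G) (χ : K → ℂ) : H → ℂ :=
  open scoped Classical in
  fun h => if hh : (h : G) ∈ K then χ ⟨_, hh⟩ else 0

/-- `χ` is the character of a (finite-dimensional, complex) representation. -/
def IsChar {G : Type} [Group G] (χ : G → ℂ) : Prop :=
  ∃ (V : Type) (_ : AddCommGroup V) (_ : Module ℂ V) (ρ : Representation ℂ G V),
    FiniteDimensional ℂ V ∧ ∀ g, χ g = LinearMap.trace ℂ V (ρ g)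

/-- `χ` is an irreducible character: a genuine character of norm one. -/
def IsIrrChar {G : Type} [Group G] (χ : G → ℂ) : Prop :=
  IsChar χ ∧ cinner χ χ = 1

/-- Multiplicity of `χE` in the `d`-th symmetric power of the reflection
representation (with character `χR`). -/
def bMult {G : Type} [Group G] (χR χE : G → ℂ) (d : ℕ) : ℂ :=
  cinner χE (symChar χR d)

/-- `b` is the `b`-invariant of `χE`: the least degree of the symmetric algebra of
the reflection representation containing `χE`. -/
def IsBAt {G : Type} [Group G] (χR χE : G → ℂ) (b : ℕ) : Prop :=
  bMult χR χE b ≠ 0 ∧ ∀ d < b, bMult χR χE d = 0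

/-- `χE = j_H^K (χE')` (GP 5.2.6): `χE` is an irreducible character of `K` occurring
in the induction of `χE'` from `H`, with the same `b`-invariant as `χE'`, where `χE'`
occurs with multiplicity one in the corresponding symmetric power for `H`; the
reflection characters of `H` and `K` are the restrictions of the ambient reflection
character `χR`. -/
def IsJInd {G : Type} [Group G] (χR : G → ℂ) (H K : Subgroup G)
    (χE' : H → ℂ) (χE : K → ℂ) : Prop :=
  IsIrrChar χE ∧ cinner χE (indChar H K χE') ≠ 0 ∧
  ∃ b, IsBAt (resChar H χR) χE' b ∧ bMult (resChar H χR) χE' b = 1 ∧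
    IsBAt (resChar K χR) χE b

/-! ### The hyperoctahedral group and its reflection subgroups.

We realize `W_n` (type `B_n/C_n`) as the permutations of `Fin n ⊕ Fin n`
(thought of as `{1,…,n} ⊔ {-1,…,-n}`) generated by the reflections below; `W'_n`
(type `D_n`) and the various reflection subgroups are likewise generated by the
appropriate reflections. -/

/-- Ambient permutation group of the `2n` points. -/
abbrev PG (n : ℕ) := Equiv.Perm (Fin n ⊕ Fin n)

/-- The reflection-representation matrix of a signed permutation. -/
def Mrefl {n : ℕ} (π : PG n) : Matrix (Fin n) (Fin n) ℂ :=
  Matrix.of fun j i =>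
    (if π (Sum.inl i) = Sum.inl j then 1 else 0) -
      (if π (Sum.inl i) = Sum.inr j then 1 else 0)

/-- The character of the reflection representation (on signed permutations). -/
def reflChar {n : ℕ} : PG n → ℂ := fun π => (Mrefl π).trace

/-- The sign (determinant) character of the reflection representation. -/
def sgnChar {n : ℕ} : PG n → ℂ := fun π => (Mrefl π).det

/-- The reflection `(e_i ↔ e_j)` (a double transposition). -/
def dsw {n : ℕ} (i j : Fin n) : PG n :=
  Equiv.swap (Sum.inl i) (Sum.inl j) * Equiv.swap (Sum.inr i) (Sum.inr j)

/-- The reflection `e_i ↦ -e_i` (a sign change). -/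
def ssw {n : ℕ} (i : Fin n) : PG n := Equiv.swap (Sum.inl i) (Sum.inr i)

/-- The reflection `e_i ↦ -e_j, e_j ↦ -e_i`. -/
def msw {n : ℕ} (i j : Fin n) : PG n :=
  Equiv.swap (Sum.inl i) (Sum.inr j) * Equiv.swap (Sum.inr i) (Sum.inl j)

/-- Types of blocks: symmetric group (`A`-type), hyperoctahedral (`B`-type),
even-signed (`D`-type). -/
inductive BTy | S | B | D
deriving DecidableEq

/-- The reflection subgroup of `W_n` determined by a block structure: `f` assigns to
each index its block, `ty` the type of each index.  On an `S`-block only the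
transpositions `dsw` act, on a `B`-block also the sign changes, on a `D`-block the
`dsw` and the `msw`.  (`W_{m₁} × … `-style products of reflection subgroups.) -/
def blkSub (n : ℕ) (f : Fin n → ℕ) (ty : Fin n → BTy) : Subgroup (PG n) :=
  Subgroup.closure
    ({π | ∃ i j, f i = f j ∧ π = dsw i j} ∪
     {π | ∃ i, ty i = BTy.B ∧ π = ssw i} ∪
     {π | ∃ i j, f i = f j ∧ ty i = BTy.D ∧ ty j = BTy.D ∧ π = msw i j})

/-- The hyperoctahedral group `W_n` (Weyl group of type `B_n/C_n`). -/
def BWn (n : ℕ) : Subgroup (PG n) := blkSub n (fun _ => 0) (fun _ => BTy.B)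

/-- The Weyl group `W'_n` of type `D_n` (the even elements of `W_n`). -/
def DWn (n : ℕ) : Subgroup (PG n) := blkSub n (fun _ => 0) (fun _ => BTy.D)

/-- The block of the index `i`, for blocks of consecutive sizes `c 0, c 1, …`
(`N` blocks in total). -/
def blockOf (N : ℕ) (c : ℕ → ℕ) (i : ℕ) : ℕ :=
  ((Finset.range N).filter fun b => ∑ b' ∈ Finset.range (b + 1), c b' ≤ i).card

/-- The linear character of (a reflection subgroup of) `W_n` given by the product of
the signs of the coordinates in `T`. -/
def epsOn {n : ℕ} (T : Set (Fin n)) : PG n → ℂ :=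
  open scoped Classical in
  fun π => ∏ᶠ i : Fin n, if i ∈ T ∧ (∃ j, π (Sum.inl i) = Sum.inr j) then -1 else 1

/-- The basic induced character of `W_n` attached to two sequences of (possibly
negative, in which case the character is `0`) block sizes: the character induced from
the product of the hyperoctahedral groups of the blocks, of the (trivial) ⊠ (product
of signs of coordinates) character, the second family of blocks carrying the
sign-of-coordinates character.  (These are the `h`-pieces of the Jacobi–Trudi-type
formula for the irreducible characters of `W_n`.) -/
def indPiece (n r s : ℕ) (c : Fin r → ℤ) (d : Fin s → ℤ) : (BWn n) → ℂ :=
  open scoped Classical in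
  if (∀ i, 0 ≤ c i) ∧ (∀ j, 0 ≤ d j) ∧ ((∑ i, c i) + ∑ j, d j) = (n : ℤ) then
    letI cs : ℕ → ℕ := fun b =>
      if hb : b < r then (c ⟨b, hb⟩).toNat
      else if hb' : b - r < s then (d ⟨b - r, hb'⟩).toNat else 0
    letI f : Fin n → ℕ := fun i => blockOf (r + s) cs (i : ℕ)
    indChar (blkSub n f (fun _ => BTy.B)) (BWn n)
      (resChar _ (epsOn {i | r ≤ f i}))
  else 0

/-- The irreducible character of the hyperoctahedral group `W_n` attached to a
bipartition `(α, β)` (each written as a weakly decreasing integer vector), via the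
Jacobi–Trudi-type determinantal formula
`χ_{(α,β)} = ∑_{σ,τ} sgn(σ)sgn(τ) · indPiece((αᵢ - i + σ(i))ᵢ, (βⱼ - j + τ(j))ⱼ)`. -/
def chiB (n r s : ℕ) (α : Fin r → ℤ) (β : Fin s → ℤ) : (BWn n) → ℂ :=
  fun w => ∑ᶠ σ : Equiv.Perm (Fin r), ∑ᶠ τ : Equiv.Perm (Fin s),
    (((Equiv.Perm.sign σ : ℤ) * (Equiv.Perm.sign τ : ℤ) : ℤ) : ℂ) *
      indPiece n r s (fun i => α i - (i : ℕ) + ((σ i : ℕ) : ℤ))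
        (fun j => β j - (j : ℕ) + ((τ j : ℕ) : ℤ)) w

/-- The irreducible character of `W_n` attached to a symbol
`[(λ₀ < … < λ_m), (μ₀ < … < μ_{m-1})]` (rows written as increasing sequences, with
`∑λ + ∑μ = m² + n`): subtract the staircases to get the bipartition. -/
def chiBSymbol (n m : ℕ) (row1 : Fin (m + 1) → ℕ) (row2 : Fin m → ℕ) : (BWn n) → ℂ :=
  chiB n (m + 1) m
    (fun i => (row1 ⟨m - (i : ℕ), by have := i.isLt; omega⟩ : ℤ) - ((m - (i : ℕ) : ℕ) : ℤ))
    (fun j => (row2 ⟨m - 1 - (j : ℕ), by have := j.isLt; omega⟩ : ℤ) -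
      ((m - 1 - (j : ℕ) : ℕ) : ℤ))

/-- The irreducible character of `W'_n` (type `D_n`) attached to a symbol
`[(λ₀ < … < λ_{m-1}), (μ₀ < … < μ_{m-1})]` with distinct rows (`∑λ + ∑μ = m² - m + n`):
the restriction to `W'_n` of the corresponding character of `W_n`. -/
def chiDSymbol (n m : ℕ) (row1 row2 : Fin m → ℕ) : (DWn n) → ℂ :=
  resSub (DWn n) (BWn n)
    (chiB n m m
      (fun i => (row1 ⟨m - 1 - (i : ℕ), by have := i.isLt; omega⟩ : ℤ) -
        ((m - 1 - (i : ℕ) : ℕ) : ℤ))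
      (fun j => (row2 ⟨m - 1 - (j : ℕ), by have := j.isLt; omega⟩ : ℤ) -
        ((m - 1 - (j : ℕ) : ℕ) : ℤ)))

section SymmetricPower

open MvPolynomial

variable {n : ℕ}

/-- The linear form with coefficient vector `v`. -/
def linForm (v : Fin n → ℂ) : MvPolynomial (Fin n) ℂ := ∑ j, C (v j) * X j

/-- The substitution action of a matrix on polynomials. -/
def matAct (A : Matrix (Fin n) (Fin n) ℂ) :
    MvPolynomial (Fin n) ℂ →ₐ[ℂ] MvPolynomial (Fin n) ℂ :=
  aeval fun i => linForm fun j => A j i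

lemma isHomogeneous_linForm (v : Fin n → ℂ) : (linForm v).IsHomogeneous 1 :=
  IsHomogeneous.sum _ _ _ fun j _ => by
    simpa using (isHomogeneous_C (Fin n) (v j)).mul (isHomogeneous_X ℂ j)

lemma matAct_X (A : Matrix (Fin n) (Fin n) ℂ) (i : Fin n) :
    matAct A (X i) = linForm fun j => A j i := by
  simp [matAct]

lemma matAct_linForm (A : Matrix (Fin n) (Fin n) ℂ) (v : Fin n → ℂ) :
    matAct A (linForm v) = linForm (A.mulVec v) := by
  simp only [linForm, map_sum, map_mul, matAct_X, algHom_C, Finset.mul_sum, Matrix.mulVec,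
    dotProduct, Finset.sum_mul]
  rw [Finset.sum_comm]
  refine Finset.sum_congr rfl fun j _ => Finset.sum_congr rfl fun i _ => ?_
  simp only [algebraMap_eq]
  ring

lemma matAct_mul (A B : Matrix (Fin n) (Fin n) ℂ) :
    matAct (A * B) = (matAct A).comp (matAct B) := by
  refine MvPolynomial.algHom_ext fun i => ?_
  simp only [AlgHom.comp_apply, matAct_X, matAct_linForm]
  rfl

lemma matAct_one : matAct (1 : Matrix (Fin n) (Fin n) ℂ) = AlgHom.id ℂ _ := by
  refine MvPolynomial.algHom_ext fun i => ?_
  simp [matAct_X, linForm, Matrix.one_apply]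

lemma isHomogeneous_matAct (A : Matrix (Fin n) (Fin n) ℂ) {f : MvPolynomial (Fin n) ℂ} {d : ℕ}
    (hf : f.IsHomogeneous d) : (matAct A f).IsHomogeneous d := by
  simpa [matAct] using hf.aeval (fun i => linForm fun j => A j i) fun i => isHomogeneous_linForm _

/-- Homogeneous polynomials of degree `d` in `n` variables. -/
abbrev HPoly (n d : ℕ) := homogeneousSubmodule (Fin n) ℂ d

instance finiteDimensional_hPoly (n d : ℕ) : FiniteDimensional ℂ (HPoly n d) :=
  Module.Finite.iff_fg.2 (homogeneousSubmodule_fg (Fin n) ℂ d)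

/-- The action of a matrix on homogeneous polynomials of degree `d`. -/
def hAct (A : Matrix (Fin n) (Fin n) ℂ) (d : ℕ) : HPoly n d →ₗ[ℂ] HPoly n d :=
  (matAct A).toLinearMap.restrict fun _ hf => isHomogeneous_matAct A hf

/-- Multiplication by a linear form. -/
def hMul (v : Fin n → ℂ) (d : ℕ) : HPoly n d →ₗ[ℂ] HPoly n (d + 1) :=
  (LinearMap.mulLeft ℂ (linForm v)).restrict fun f hf => by
    simpa [add_comm] using (isHomogeneous_linForm v).mul hf

/-- Partial derivative on homogeneous polynomials. -/
def hDeriv (i : Fin n) (d : ℕ) : HPoly n (d + 1) →ₗ[ℂ] HPoly n d :=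
  (pderiv i).toLinearMap.restrict fun f hf => by
    simpa using IsHomogeneous.pderiv (i := i) hf

@[simp] lemma coe_hAct (A : Matrix (Fin n) (Fin n) ℂ) (d : ℕ) (f : HPoly n d) :
    (hAct A d f : MvPolynomial (Fin n) ℂ) = matAct A f := rfl

@[simp] lemma coe_hMul (v : Fin n → ℂ) (d : ℕ) (f : HPoly n d) :
    (hMul v d f : MvPolynomial (Fin n) ℂ) = linForm v * f := rfl

@[simp] lemma coe_hDeriv (i : Fin n) (d : ℕ) (f : HPoly n (d + 1)) :
    (hDeriv i d f : MvPolynomial (Fin n) ℂ) = pderiv i (f : MvPolynomial (Fin n) ℂ) := rfl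

lemma linForm_single (i : Fin n) : linForm (Pi.single i 1) = X i := by
  simp [linForm, Pi.single_apply]

lemma pderiv_linForm (i : Fin n) (v : Fin n → ℂ) : pderiv i (linForm v) = C (v i) := by
  simp [linForm, pderiv_X, Pi.single_apply]

lemma sum_hMul_hDeriv (d : ℕ) :
    ∑ i : Fin n, hMul (Pi.single i 1) d ∘ₗ hDeriv i d = ((d + 1 : ℕ) : ℂ) • LinearMap.id := by
  ext1 f
  apply Subtype.ext
  have := IsHomogeneous.sum_X_mul_pderiv f.2
  simp only [LinearMap.sum_apply, LinearMap.comp_apply, AddSubmonoidClass.coe_finsetSum, coe_hMul,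
    coe_hDeriv, linForm_single, this]
  simp [nsmul_eq_mul, smul_eq_C_mul]

lemma hAct_comp_hMul (A : Matrix (Fin n) (Fin n) ℂ) (v : Fin n → ℂ) (d : ℕ) :
    hAct A (d + 1) ∘ₗ hMul v d = hMul (A.mulVec v) d ∘ₗ hAct A d := by
  ext1 f
  apply Subtype.ext
  simp [matAct_linForm]

lemma hDeriv_comp_hMul (i : Fin n) (v : Fin n → ℂ) (d : ℕ) :
    hDeriv i (d + 1) ∘ₗ hMul v (d + 1) = v i • LinearMap.id + hMul v d ∘ₗ hDeriv i d := by
  ext1 f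
  apply Subtype.ext
  simp [pderiv_linForm, smul_eq_C_mul, mul_comm]

lemma hDeriv_comp_hMul_zero (i : Fin n) (v : Fin n → ℂ) :
    hDeriv i 0 ∘ₗ hMul v 0 = v i • LinearMap.id := by
  ext1 f
  apply Subtype.ext
  have h0 : pderiv i (f : MvPolynomial (Fin n) ℂ) = 0 := by
    rw [totalDegree_eq_zero_iff_eq_C.1 (Nat.le_zero.1 (IsHomogeneous.totalDegree_le f.2))]
    simp
  simp [pderiv_linForm, smul_eq_C_mul, h0, mul_comm]

/-- The auxiliary traces interpolating between `d * tr (Sym^d A)` and the Newton sum. -/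
def polarTrace (A : Matrix (Fin n) (Fin n) ℂ) (k d : ℕ) : ℂ :=
  ∑ i : Fin n, LinearMap.trace ℂ (HPoly n (d + 1))
    (hMul ((A ^ k).mulVec (Pi.single i 1)) d ∘ₗ hAct A d ∘ₗ hDeriv i d)

lemma polarTrace_eq_sum (A : Matrix (Fin n) (Fin n) ℂ) (k d : ℕ) :
    polarTrace A k d = ∑ i : Fin n, LinearMap.trace ℂ (HPoly n d)
      (hAct A d ∘ₗ hDeriv i d ∘ₗ hMul ((A ^ k).mulVec (Pi.single i 1)) d) := by
  refine Finset.sum_congr rfl fun i _ => ?_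
  rw [LinearMap.trace_comp_comm']
  rfl

lemma sum_mulVec_single (B : Matrix (Fin n) (Fin n) ℂ) :
    ∑ i, B.mulVec (Pi.single i 1) i = B.trace := by
  simp [Matrix.trace, Matrix.mulVec_single]

lemma polarTrace_zero (A : Matrix (Fin n) (Fin n) ℂ) (k : ℕ) :
    polarTrace A k 0 = (A ^ k).trace * LinearMap.trace ℂ _ (hAct A 0) := by
  rw [polarTrace_eq_sum, ← sum_mulVec_single, Finset.sum_mul]
  refine Finset.sum_congr rfl fun i _ => ?_
  rw [hDeriv_comp_hMul_zero, LinearMap.comp_smul, map_smul, LinearMap.comp_id, smul_eq_mul]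

lemma polarTrace_succ (A : Matrix (Fin n) (Fin n) ℂ) (k d : ℕ) :
    polarTrace A k (d + 1) =
      (A ^ k).trace * LinearMap.trace ℂ _ (hAct A (d + 1)) + polarTrace A (k + 1) d := by
  rw [polarTrace_eq_sum, ← sum_mulVec_single, Finset.sum_mul, polarTrace, ← Finset.sum_add_distrib]
  refine Finset.sum_congr rfl fun i _ => ?_
  rw [hDeriv_comp_hMul, LinearMap.comp_add, LinearMap.comp_smul, map_add, map_smul,
    LinearMap.comp_id, smul_eq_mul, ← LinearMap.comp_assoc, hAct_comp_hMul, Matrix.mulVec_mulVec,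
    ← pow_succ', LinearMap.comp_assoc]

lemma polarTrace_eq_newton (A : Matrix (Fin n) (Fin n) ℂ) (k d : ℕ) :
    polarTrace A k d = ∑ j ∈ Finset.range (d + 1),
      (A ^ (k + j)).trace * LinearMap.trace ℂ _ (hAct A (d - j)) := by
  induction d generalizing k with
  | zero => simp [polarTrace_zero]
  | succ d ih =>
    rw [polarTrace_succ, ih, Finset.sum_range_succ' _ (d + 1), add_comm]
    congr 1
    refine Finset.sum_congr rfl fun j _ => ?_
    rw [Nat.succ_sub_succ, show k + 1 + j = k + (j + 1) by ring]

lemma trace_hAct_zero (A : Matrix (Fin n) (Fin n) ℂ) :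
    LinearMap.trace ℂ (HPoly n 0) (hAct A 0) = 1 := by
  have h1 : hAct A 0 = LinearMap.id := by
    ext1 f
    apply Subtype.ext
    have : (f : MvPolynomial (Fin n) ℂ) = C _ :=
      totalDegree_eq_zero_iff_eq_C.1 (Nat.le_zero.1 (IsHomogeneous.totalDegree_le f.2))
    rw [coe_hAct, LinearMap.id_apply, this]
    simp
  rw [h1, LinearMap.trace_id]
  have : Module.finrank ℂ (HPoly n 0) = 1 := by
    refine (finrank_eq_one_iff_of_nonzero' (⟨1, isHomogeneous_one _ _⟩ : HPoly n 0) ?_).2 ?_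
    · intro h
      exact one_ne_zero (congrArg Subtype.val h)
    · intro f
      refine ⟨coeff 0 (f : MvPolynomial (Fin n) ℂ), Subtype.ext ?_⟩
      have := totalDegree_eq_zero_iff_eq_C.1 (Nat.le_zero.1 (IsHomogeneous.totalDegree_le f.2))
      conv_rhs => rw [this]
      simp [smul_eq_C_mul]
  rw [this, Nat.cast_one]

lemma trace_hAct_succ (A : Matrix (Fin n) (Fin n) ℂ) (d : ℕ) :
    LinearMap.trace ℂ _ (hAct A (d + 1)) = ((d : ℂ) + 1)⁻¹ * ∑ k ∈ Finset.range (d + 1),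
      (A ^ (k + 1)).trace * LinearMap.trace ℂ _ (hAct A (d - k)) := by
  have h : ((d : ℂ) + 1) * LinearMap.trace ℂ _ (hAct A (d + 1)) = polarTrace A 1 d := by
    have := congrArg (fun L => LinearMap.trace ℂ _ (hAct A (d + 1) ∘ₗ L)) (sum_hMul_hDeriv (n := n) d)
    simp only [LinearMap.comp_smul, map_smul, LinearMap.comp_id, smul_eq_mul, Nat.cast_add,
      Nat.cast_one] at this
    rw [← this, polarTrace, ← Module.End.mul_eq_comp, Finset.mul_sum, map_sum]
    refine Finset.sum_congr rfl fun i _ => ?_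
    rw [Module.End.mul_eq_comp, ← LinearMap.comp_assoc, hAct_comp_hMul, pow_one,
      LinearMap.comp_assoc]
  have h0 : ((d : ℂ) + 1) ≠ 0 := Nat.cast_add_one_ne_zero d
  rw [eq_inv_mul_iff_mul_eq₀ h0, h, polarTrace_eq_newton]
  simp only [add_comm]

/-- Newton's recursion computes the trace on symmetric powers. -/
lemma symChar_eq_trace {G : Type} [Group G] (χ : G → ℂ) (g : G) (A : Matrix (Fin n) (Fin n) ℂ)
    (h : ∀ k, χ (g ^ (k + 1)) = (A ^ (k + 1)).trace) (d : ℕ) :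
    symChar χ d g = LinearMap.trace ℂ _ (hAct A d) := by
  induction d using Nat.strong_induction_on with
  | _ d ih =>
    cases d with
    | zero => rw [symChar, trace_hAct_zero]
    | succ d =>
      rw [symChar, trace_hAct_succ]
      congr 1
      refine Finset.sum_congr rfl fun k _ => ?_
      rw [h, ih (d - k) (by omega)]

end SymmetricPower

section GroupTheory

variable {n : ℕ}

/-- Permutations commuting with the negation of the `2n` points. -/
def IsSigned (π : PG n) : Prop := ∀ x, π x.swap = (π x).swap

lemma IsSigned.one : IsSigned (1 : PG n) := fun _ => rfl

lemma IsSigned.mul {π τ : PG n} (h : IsSigned π) (h' : IsSigned τ) : IsSigned (π * τ) := fun x => by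
  simp [h' x, h (τ x)]

lemma IsSigned.inv {π : PG n} (h : IsSigned π) : IsSigned π⁻¹ := fun x => by
  rw [Equiv.Perm.inv_eq_iff_eq, h, ← Equiv.Perm.mul_apply, mul_inv_cancel, Equiv.Perm.one_apply]

lemma isSigned_ssw (i : Fin n) : IsSigned (ssw i) := by
  rintro (x | x) <;> simp only [ssw, Equiv.swap_apply_def, Sum.swap_inl, Sum.swap_inr] <;>
    split_ifs <;> simp_all

lemma dsw_inl (i j x : Fin n) : dsw i j (Sum.inl x) = Sum.inl (Equiv.swap i j x) := by
  simp only [dsw, Equiv.Perm.mul_apply, Equiv.swap_apply_def]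
  split_ifs <;> simp_all

lemma dsw_inr (i j x : Fin n) : dsw i j (Sum.inr x) = Sum.inr (Equiv.swap i j x) := by
  simp only [dsw, Equiv.Perm.mul_apply, Equiv.swap_apply_def]
  split_ifs <;> simp_all

lemma isSigned_dsw (i j : Fin n) : IsSigned (dsw i j) := by
  rintro (x | x) <;> simp [dsw_inl, dsw_inr]

lemma msw_self (i : Fin n) : msw i i = 1 := by
  simp [msw, Equiv.swap_comm (Sum.inr i) (Sum.inl i)]

lemma msw_eq {i j : Fin n} (h : i ≠ j) : msw i j = ssw i * (ssw j * dsw i j) := by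
  refine Equiv.ext ?_
  rintro (x | x) <;>
    simp only [msw, Equiv.Perm.mul_apply, dsw_inl, dsw_inr, ssw, Equiv.swap_apply_def] <;>
    grind

lemma ssw_mem_BWn (i : Fin n) : ssw i ∈ BWn n :=
  Subgroup.subset_closure (Or.inl (Or.inr ⟨i, rfl, rfl⟩))

lemma dsw_mem_BWn (i j : Fin n) : dsw i j ∈ BWn n :=
  Subgroup.subset_closure (Or.inl (Or.inl ⟨i, j, rfl, rfl⟩))

lemma msw_mem_BWn (i j : Fin n) : msw i j ∈ BWn n := by
  rcases eq_or_ne i j with rfl | h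
  · rw [msw_self]
    exact one_mem _
  · rw [msw_eq h]
    exact mul_mem (ssw_mem_BWn i) (mul_mem (ssw_mem_BWn j) (dsw_mem_BWn i j))

lemma blkSub_le_BWn (f : Fin n → ℕ) (ty : Fin n → BTy) : blkSub n f ty ≤ BWn n := by
  refine (Subgroup.closure_le _).2 ?_
  rintro π ((⟨i, j, -, rfl⟩ | ⟨i, -, rfl⟩) | ⟨i, j, -, -, -, rfl⟩)
  · exact dsw_mem_BWn i j
  · exact ssw_mem_BWn i
  · exact msw_mem_BWn i j

lemma isSigned_of_mem_BWn {π : PG n} (h : π ∈ BWn n) : IsSigned π := by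
  refine Subgroup.closure_induction (p := fun π _ => IsSigned π) ?_ IsSigned.one
    (fun _ _ _ _ => IsSigned.mul) (fun _ _ => IsSigned.inv) h
  rintro π ((⟨i, j, -, rfl⟩ | ⟨i, -, rfl⟩) | ⟨i, j, -, h, -, rfl⟩)
  · exact isSigned_dsw i j
  · exact isSigned_ssw i
  · cases h

lemma Mrefl_one : Mrefl (1 : PG n) = 1 := by
  ext j i
  simp [Mrefl, Matrix.one_apply, eq_comm]

/-- The `j`-th coordinate of the signed basis vector labelled by `x`. -/
def signedCoord (j : Fin n) (x : Fin n ⊕ Fin n) : ℂ :=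
  (if x = Sum.inl j then 1 else 0) - (if x = Sum.inr j then 1 else 0)

lemma Mrefl_apply (π : PG n) (j i : Fin n) : Mrefl π j i = signedCoord j (π (Sum.inl i)) := rfl

lemma signedCoord_inl (j k : Fin n) : signedCoord j (Sum.inl k) = if k = j then 1 else 0 := by
  simp [signedCoord]

lemma signedCoord_inr (j k : Fin n) : signedCoord j (Sum.inr k) = -if k = j then 1 else 0 := by
  simp [signedCoord]

lemma signedCoord_swap (j : Fin n) (x : Fin n ⊕ Fin n) :
    signedCoord j x.swap = -signedCoord j x := by
  rcases x with x | x <;> simp [signedCoord]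

lemma Mrefl_mul {π τ : PG n} (h : IsSigned π) : Mrefl (π * τ) = Mrefl π * Mrefl τ := by
  ext j i
  have key : ∀ k, π (Sum.inr k) = (π (Sum.inl k)).swap := fun k => h (Sum.inl k)
  simp only [Mrefl_apply, Matrix.mul_apply, Equiv.Perm.mul_apply]
  rcases τ (Sum.inl i) with k | k
  · simp [signedCoord_inl]
  · rw [key, signedCoord_swap]
    simp [signedCoord_inr]

/-- The reflection representation matrices, as a homomorphism on the hyperoctahedral group. -/
def MreflHom (n : ℕ) : BWn n →* Matrix (Fin n) (Fin n) ℂ where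
  toFun w := Mrefl (w : PG n)
  map_one' := Mrefl_one
  map_mul' w _ := Mrefl_mul (isSigned_of_mem_BWn w.2)

/-- The sign character as a homomorphism on a subgroup of the hyperoctahedral group. -/
def sgnHom {H : Subgroup (PG n)} (hH : H ≤ BWn n) : H →* ℂ :=
  (Matrix.detMonoidHom.comp (MreflHom n)).comp (Subgroup.inclusion hH)

lemma sgnHom_apply {H : Subgroup (PG n)} (hH : H ≤ BWn n) (h : H) :
    sgnHom hH h = sgnChar (h : PG n) := rfl

/-- The representation of the hyperoctahedral group on homogeneous polynomials. -/
def polyRep (n d : ℕ) : Representation ℂ (BWn n) (HPoly n d) where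
  toFun w := hAct (MreflHom n w) d
  map_one' := by
    ext1 f
    apply Subtype.ext
    simp [matAct_one]
  map_mul' w w' := by
    ext1 f
    apply Subtype.ext
    simp [matAct_mul]

lemma coe_polyRep {d : ℕ} (w : BWn n) (f : HPoly n d) :
    (polyRep n d w f : MvPolynomial (Fin n) ℂ) = matAct (Mrefl (w : PG n)) f := rfl

lemma symChar_reflChar {H : Subgroup (PG n)} (hH : H ≤ BWn n) (h : H) (d : ℕ) :
    symChar (resChar H reflChar) d h =
      LinearMap.trace ℂ _ (polyRep n d (Subgroup.inclusion hH h)) := by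
  refine symChar_eq_trace _ _ _ (fun k => ?_) d
  rw [← map_pow, ← map_pow]
  rfl

end GroupTheory

section Characters

variable {G V : Type} [Group G] [Finite G] [AddCommGroup V] [Module ℂ V] [FiniteDimensional ℂ V]

/-- The subspace on which `G` acts through the linear character `l`. -/
def eigenSpace (ρ : Representation ℂ G V) (l : G →* ℂ) : Submodule ℂ V where
  carrier := {v | ∀ g, ρ g v = l g • v}
  add_mem' := fun ha hb g => by rw [map_add, ha g, hb g, smul_add]
  zero_mem' := fun g => by simp
  smul_mem' := fun c v hv g => by rw [map_smul, hv g, smul_comm]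

/-- The twist of a representation by the inverse of a linear character. -/
def twist (ρ : Representation ℂ G V) (l : G →* ℂ) : Representation ℂ G V where
  toFun g := l g⁻¹ • ρ g
  map_one' := by simp
  map_mul' g h := by
    rw [mul_inv_rev, map_mul, map_mul, smul_mul_smul_comm, mul_comm (l h⁻¹)]

omit [Finite G] [FiniteDimensional ℂ V] in
lemma invariants_twist (ρ : Representation ℂ G V) (l : G →* ℂ) :
    (twist ρ l).invariants = eigenSpace ρ l := by
  ext v
  refine forall_congr' fun g => ?_
  have h : l g * l g⁻¹ = 1 := by rw [← map_mul, mul_inv_cancel, map_one]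
  have h' : l g⁻¹ * l g = 1 := by rw [mul_comm, h]
  change l g⁻¹ • ρ g v = v ↔ _
  constructor <;> intro hv
  · conv_rhs => rw [← hv, smul_smul, h, one_smul]
  · rw [hv, smul_smul, h', one_smul]

lemma cinner_eq_finrank_eigenSpace (ρ : Representation ℂ G V) (l : G →* ℂ) :
    cinner l (fun g => LinearMap.trace ℂ V (ρ g)) = Module.finrank ℂ (eigenSpace ρ l) := by
  have := Fintype.ofFinite G
  have : Invertible (Nat.card G : ℂ) := invertibleOfNonzero (by simp)
  rw [← invariants_twist, ← Representation.card_inv_mul_sum_char_eq_finrank, cinner,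
    finsum_eq_sum_of_fintype, ← Equiv.sum_comp (Equiv.inv G)]
  congr 1
  refine Finset.sum_congr rfl fun g _ => ?_
  simp [Representation.character, twist]

lemma cinner_comm (φ ψ : G → ℂ) : cinner φ ψ = cinner ψ φ := by
  have := Fintype.ofFinite G
  rw [cinner, cinner, finsum_eq_sum_of_fintype, finsum_eq_sum_of_fintype,
    ← Equiv.sum_comp (Equiv.inv G)]
  simp [mul_comm]

variable {U : Type} [AddCommGroup U] [Module ℂ U] [FiniteDimensional ℂ U]

lemma cinner_char_eq_finrank (ρ : Representation ℂ G V) (σ : Representation ℂ G U) :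
    cinner (fun g => LinearMap.trace ℂ V (ρ g)) (fun g => LinearMap.trace ℂ U (σ g)) =
      Module.finrank ℂ (Representation.IntertwiningMap σ ρ) := by
  have := Fintype.ofFinite G
  have : Invertible (Nat.card G : ℂ) := invertibleOfNonzero (by simp)
  rw [← Representation.card_inv_mul_sum_char_mul_char_eq_finrank, cinner, finsum_eq_sum_of_fintype]
  rfl

open scoped MonoidAlgebra in
lemma isIrreducible_of_cinner_eq_one (ρ : Representation ℂ G V)
    (h : cinner (fun g => LinearMap.trace ℂ V (ρ g)) (fun g => LinearMap.trace ℂ V (ρ g)) = 1) :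
    ρ.IsIrreducible := by
  have : NeZero (Nat.card G : ℂ) := ⟨Nat.cast_ne_zero.2 Nat.card_pos.ne'⟩
  rw [cinner_char_eq_finrank, Nat.cast_eq_one,
    (Representation.IntertwiningMap.equivAlgEnd (ρ := ρ)).toLinearEquiv.finrank_eq] at h
  have h1 : (1 : Module.End (MonoidAlgebra ℂ G) ρ.asModule) ≠ 0 := by
    intro h0
    have : Subsingleton (Module.End (MonoidAlgebra ℂ G) ρ.asModule) :=
      subsingleton_of_zero_eq_one h0.symm
    rw [Module.finrank_zero_of_subsingleton] at h
    exact zero_ne_one h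
  rw [Representation.irreducible_iff_isSimpleModule_asModule, isSimpleModule_iff]
  have hnt : Nontrivial ρ.asModule := by
    by_contra hn
    rw [not_nontrivial_iff_subsingleton] at hn
    exact h1 (Subsingleton.elim _ _)
  refine { exists_pair_ne := ⟨⊥, ⊤, bot_ne_top⟩, eq_bot_or_eq_top := fun p => ?_ }
  obtain ⟨q, hq⟩ := MonoidAlgebra.Submodule.exists_isCompl p
  obtain ⟨c, hc⟩ := (finrank_eq_one_iff_of_nonzero' _ h1).1 h
    (p.subtype ∘ₗ Submodule.projectionOnto p q hq)
  by_cases h0 : c = 0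
  · left
    rw [eq_bot_iff]
    intro x hx
    have := LinearMap.congr_fun hc x
    simp only [h0, zero_smul, LinearMap.zero_apply, LinearMap.comp_apply] at this
    rw [Submodule.projectionOnto_apply_left hq ⟨x, hx⟩] at this
    exact this.symm
  · right
    rw [eq_top_iff]
    intro x _
    have := LinearMap.congr_fun hc x
    have hmem : c • x ∈ p := by
      change c • x = _ at this
      rw [this]
      exact Subtype.property _
    have := p.smul_of_tower_mem c⁻¹ hmem
    rwa [smul_smul, inv_mul_cancel₀ h0, one_smul] at this

end Characters

section Frobenius

lemma cinner_indChar {G : Type} [Group G] [Finite G] {H K : Subgroup G} (hHK : H ≤ K)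
    (χ : K → ℂ) (hχ : ∀ x g : K, χ (x * g * x⁻¹) = χ g) (φ : H → ℂ) :
    cinner χ (indChar H K φ) = cinner (fun h => χ (Subgroup.inclusion hHK h)) φ := by
  classical
  have := Fintype.ofFinite G
  have hK : (Nat.card K : ℂ) ≠ 0 := Nat.cast_ne_zero.2 Nat.card_pos.ne'
  let F : K → ℂ := fun g => if h : (g : G) ∈ H then φ ⟨g, h⟩ else 0
  have hind : ∀ g : K, indChar H K φ g = (Nat.card H : ℂ)⁻¹ * ∑ x : K, F (x * g * x⁻¹) := by
    intro g
    rw [indChar, finsum_eq_sum_of_fintype]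
    congr 1
  have hx : ∀ x : K, ∑ g : K, χ g * F (x * g⁻¹ * x⁻¹) = ∑ g : K, χ g * F g⁻¹ := by
    intro x
    rw [← Equiv.sum_comp (MulAut.conj x).toEquiv fun g => χ g * F g⁻¹]
    refine Finset.sum_congr rfl fun g _ => ?_
    change _ = χ (x * g * x⁻¹) * F (x * g * x⁻¹)⁻¹
    rw [hχ, show (x * g * x⁻¹)⁻¹ = x * g⁻¹ * x⁻¹ by group]
  have hH : ∑ g : K, χ g * F g⁻¹ = ∑ h : H, χ (Subgroup.inclusion hHK h) * φ h⁻¹ := by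
    symm
    refine Fintype.sum_of_injective (Subgroup.inclusion hHK) (Subgroup.inclusion_injective hHK)
      _ _ (fun g hg => ?_) (fun h => ?_)
    · have : (g : G)⁻¹ ∉ H := fun h => hg ⟨⟨g, by simpa using h⟩, rfl⟩
      simp [F, this]
    · simp only [F, Subgroup.coe_inv, Subgroup.coe_inclusion, inv_mem h.2, dif_pos]
      rfl
  rw [cinner, cinner, finsum_eq_sum_of_fintype, finsum_eq_sum_of_fintype, ← hH]
  have hsum : ∑ g : K, χ g * indChar H K φ g⁻¹ =
      (Nat.card H : ℂ)⁻¹ * ∑ x : K, ∑ g : K, χ g * F (x * g⁻¹ * x⁻¹) := by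
    rw [Finset.sum_comm, Finset.mul_sum]
    refine Finset.sum_congr rfl fun g _ => ?_
    rw [hind, mul_left_comm, Finset.mul_sum]
  rw [hsum, Finset.sum_congr rfl fun x _ => hx x, Finset.sum_const, Finset.card_univ,
    ← Nat.card_eq_fintype_card, nsmul_eq_mul]
  field_simp

end Frobenius

section Transfer

variable {n : ℕ}

/-- Homogeneous polynomials on which `H` acts through the sign character. -/
def antiSpace {H : Subgroup (PG n)} (hH : H ≤ BWn n) (d : ℕ) : Submodule ℂ (HPoly n d) :=
  eigenSpace ((polyRep n d).comp (Subgroup.inclusion hH)) (sgnHom hH)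

lemma mem_antiSpace {H : Subgroup (PG n)} (hH : H ≤ BWn n) {d : ℕ} {f : HPoly n d} :
    f ∈ antiSpace hH d ↔
      ∀ h : H, polyRep n d (Subgroup.inclusion hH h) f = sgnHom hH h • f := Iff.rfl

lemma bMult_sgnChar {H : Subgroup (PG n)} (hH : H ≤ BWn n) (d : ℕ) :
    bMult (resChar H reflChar) (resChar H sgnChar) d = Module.finrank ℂ (antiSpace hH d) := by
  rw [antiSpace, ← cinner_eq_finrank_eigenSpace, bMult]
  congr 1
  funext h
  exact symChar_reflChar hH h d

lemma cinner_indChar_sgnChar {H : Subgroup (PG n)} (hH : H ≤ BWn n) {V : Type} [AddCommGroup V]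
    [Module ℂ V] [FiniteDimensional ℂ V] (ρ : Representation ℂ (BWn n) V) :
    cinner (fun g => LinearMap.trace ℂ V (ρ g)) (indChar H (BWn n) (resChar H sgnChar)) =
      Module.finrank ℂ (eigenSpace (ρ.comp (Subgroup.inclusion hH)) (sgnHom hH)) := by
  rw [cinner_indChar hH (fun g => LinearMap.trace ℂ V (ρ g)) (fun x g => ρ.char_conj g x),
    cinner_comm, ← cinner_eq_finrank_eigenSpace]
  rfl

/-- The lowest degree in which the sign character of `H` occurs is `N`, where it occurs exactly
once, spanned by `f`. -/
structure IsLowest {H : Subgroup (PG n)} (hH : H ≤ BWn n) {N : ℕ} (f : HPoly n N) : Prop where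
  ne_zero : f ≠ 0
  mem : f ∈ antiSpace hH N
  exists_smul : ∀ g ∈ antiSpace hH N, ∃ c : ℂ, c • f = g
  eq_bot : ∀ d < N, antiSpace hH d = ⊥

lemma IsLowest.finrank_eq_one {H : Subgroup (PG n)} {hH : H ≤ BWn n} {N : ℕ} {f : HPoly n N}
    (hf : IsLowest hH f) : Module.finrank ℂ (antiSpace hH N) = 1 :=
  (finrank_eq_one_iff_of_nonzero' (⟨f, hf.mem⟩ : antiSpace hH N)
    fun h => hf.ne_zero (congrArg Subtype.val h)).2 fun g =>
      (hf.exists_smul g g.2).imp fun _ hc => Subtype.ext hc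

lemma IsLowest.isBAt {H : Subgroup (PG n)} {hH : H ≤ BWn n} {N : ℕ} {f : HPoly n N}
    (hf : IsLowest hH f) : IsBAt (resChar H reflChar) (resChar H sgnChar) N := by
  refine ⟨?_, fun d hd => ?_⟩
  · rw [bMult_sgnChar hH, hf.finrank_eq_one]
    simp
  · rw [bMult_sgnChar hH, hf.eq_bot d hd]
    simp

lemma IsBAt.unique {G : Type} [Group G] {χR χ : G → ℂ} {a b : ℕ} (ha : IsBAt χR χ a)
    (hb : IsBAt χR χ b) : a = b := by
  rcases lt_trichotomy a b with h | h | h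
  · exact absurd (hb.2 a h) ha.1
  · exact h
  · exact absurd (ha.2 b h) hb.1

lemma IsLowest.isJInd_iff {H : Subgroup (PG n)} {hH : H ≤ BWn n} {N : ℕ} {f : HPoly n N}
    (hf : IsLowest hH f) (χ : BWn n → ℂ) :
    IsJInd reflChar H (BWn n) (resChar H sgnChar) χ ↔
      IsIrrChar χ ∧ IsBAt (resChar (BWn n) reflChar) χ N ∧
        cinner χ (indChar H (BWn n) (resChar H sgnChar)) ≠ 0 := by
  constructor
  · rintro ⟨h1, h2, b, hb, -, hb'⟩
    obtain rfl := hb.unique hf.isBAt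
    exact ⟨h1, hb', h2⟩
  · rintro ⟨h1, h2, h3⟩
    refine ⟨h1, h3, N, hf.isBAt, ?_, h2⟩
    rw [bMult_sgnChar hH, hf.finrank_eq_one, Nat.cast_one]

/-- Averaging lifts sign-isotypic vectors along surjective intertwining maps. -/
lemma exists_antiSpace_lift {H : Subgroup (PG n)} (hH : H ≤ BWn n) {V : Type} [AddCommGroup V]
    [Module ℂ V] {ρ : Representation ℂ (BWn n) V} {N : ℕ}
    (φ : Representation.IntertwiningMap (polyRep n N) ρ) (hφ : Function.Surjective φ) {v : V}
    (hv : v ∈ eigenSpace (ρ.comp (Subgroup.inclusion hH)) (sgnHom hH)) :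
    ∃ g ∈ antiSpace hH N, φ g = v := by
  classical
  have := Fintype.ofFinite H
  obtain ⟨g, rfl⟩ := hφ v
  have hinv : ∀ h : H, sgnHom hH h * sgnHom hH h⁻¹ = 1 := fun h => by
    rw [← map_mul, mul_inv_cancel, map_one]
  have hc : (Fintype.card H : ℂ) ≠ 0 := Nat.cast_ne_zero.2 Fintype.card_ne_zero
  refine ⟨(Fintype.card H : ℂ)⁻¹ • ∑ h : H, sgnHom hH h⁻¹ • polyRep n N (Subgroup.inclusion hH h) g,
    ?_, ?_⟩
  · rw [mem_antiSpace]
    intro k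
    rw [map_smul, smul_comm]
    congr 1
    rw [map_sum, Finset.smul_sum]
    rw [← Equiv.sum_comp (Equiv.mulLeft k)
      fun h => sgnHom hH k • sgnHom hH h⁻¹ • polyRep n N (Subgroup.inclusion hH h) g]
    refine Finset.sum_congr rfl fun h _ => ?_
    rw [map_smul, Equiv.coe_mulLeft, mul_inv_rev, map_mul (sgnHom hH), smul_smul, mul_left_comm,
      hinv, mul_one, map_mul, map_mul]
    rfl
  · rw [map_smul, map_sum, inv_smul_eq_iff₀ hc]
    rw [Finset.sum_congr rfl fun h _ => show φ (sgnHom hH h⁻¹ •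
      polyRep n N (Subgroup.inclusion hH h) g) = φ g from ?_]
    · rw [Finset.sum_const, Finset.card_univ, ← Nat.cast_smul_eq_nsmul ℂ]
    · rw [map_smul, φ.isIntertwining]
      have := hv h
      rw [MonoidHom.comp_apply] at this
      rw [this, smul_smul, mul_comm, hinv, one_smul]

theorem isJInd_iff_of_isLowest {H₁ H₂ : Subgroup (PG n)} {hH₁ : H₁ ≤ BWn n} {hH₂ : H₂ ≤ BWn n}
    {N : ℕ} {f₁ f₂ : HPoly n N} (hf₁ : IsLowest hH₁ f₁) (hf₂ : IsLowest hH₂ f₂)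
    (hspan : ∀ U : Subrepresentation (polyRep n N), f₁ ∈ U → f₂ ∈ U) (χ : BWn n → ℂ) :
    IsJInd reflChar H₁ (BWn n) (resChar H₁ sgnChar) χ ↔
      IsJInd reflChar H₂ (BWn n) (resChar H₂ sgnChar) χ := by
  rw [hf₁.isJInd_iff, hf₂.isJInd_iff]
  refine and_congr_right fun hirr => and_congr_right fun hb => ?_
  obtain ⟨⟨V, _, _, ρ, _, hρ⟩, hnorm⟩ := hirr
  obtain rfl : χ = fun g => LinearMap.trace ℂ V (ρ g) := funext hρ
  have hirr := isIrreducible_of_cinner_eq_one ρ hnorm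
  have hN : cinner (fun g => LinearMap.trace ℂ V (ρ g))
      (fun g => LinearMap.trace ℂ _ (polyRep n N g)) ≠ 0 := by
    have := hb.1
    rw [bMult] at this
    convert this using 2
    funext g
    exact (symChar_reflChar le_rfl g N).symm
  have hN' := hN
  rw [cinner_char_eq_finrank, Nat.cast_ne_zero] at hN
  rw [cinner_comm, cinner_char_eq_finrank, Nat.cast_ne_zero] at hN'
  obtain ⟨φ, hφ⟩ : ∃ φ : Representation.IntertwiningMap (polyRep n N) ρ, φ ≠ 0 := by
    by_contra! h
    have : Subsingleton (Representation.IntertwiningMap (polyRep n N) ρ) :=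
      ⟨fun a b => by rw [h a, h b]⟩
    exact hN Module.finrank_zero_of_subsingleton
  obtain ⟨ψ, hψ⟩ : ∃ ψ : Representation.IntertwiningMap ρ (polyRep n N), ψ ≠ 0 := by
    by_contra! h
    have : Subsingleton (Representation.IntertwiningMap ρ (polyRep n N)) :=
      ⟨fun a b => by rw [h a, h b]⟩
    exact hN' Module.finrank_zero_of_subsingleton
  have hφs := (Representation.IsIrreducible.surjective_or_eq_zero φ).resolve_right hφ
  have hψi := (Representation.IsIrreducible.injective_or_eq_zero ψ).resolve_right hψ
  rw [cinner_indChar_sgnChar hH₁, cinner_indChar_sgnChar hH₂, Nat.cast_ne_zero, Nat.cast_ne_zero,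
    Ne, Ne, Submodule.finrank_eq_zero, Submodule.finrank_eq_zero, ← Ne, ← Ne, Submodule.ne_bot_iff,
    Submodule.ne_bot_iff]
  constructor
  · rintro ⟨v, hv, hv0⟩
    have hmem : ψ v ∈ antiSpace hH₁ N := by
      intro h
      rw [MonoidHom.comp_apply, ← ψ.isIntertwining, ← map_smul]
      exact congrArg ψ (hv h)
    obtain ⟨c, hc⟩ := hf₁.exists_smul _ hmem
    have hc0 : c ≠ 0 := by
      rintro rfl
      rw [zero_smul] at hc
      exact hv0 (hψi (by rw [← hc, map_zero]))
    have h1 : f₁ ∈ ψ.range := by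
      rw [Representation.IntertwiningMap.mem_range]
      exact ⟨c⁻¹ • v, by rw [map_smul, ← hc, smul_smul, inv_mul_cancel₀ hc0, one_smul]⟩
    have h2 := hspan _ h1
    rw [Representation.IntertwiningMap.mem_range] at h2
    obtain ⟨w, hw⟩ := h2
    refine ⟨w, fun h => hψi ?_, ?_⟩
    · rw [MonoidHom.comp_apply, ψ.isIntertwining, map_smul, hw]
      exact hf₂.mem h
    · rintro rfl
      exact hf₂.ne_zero (by rw [← hw, map_zero])
  · rintro ⟨v, hv, hv0⟩
    obtain ⟨g, hg, rfl⟩ := exists_antiSpace_lift hH₂ φ hφs hv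
    obtain ⟨c, rfl⟩ := hf₂.exists_smul _ hg
    refine ⟨φ f₁, fun h => ?_, fun h0 => ?_⟩
    · rw [MonoidHom.comp_apply, ← φ.isIntertwining, ← map_smul]
      exact congrArg φ (hf₁.mem h)
    · have h1 : f₁ ∈ φ.ker := by rwa [Representation.IntertwiningMap.mem_ker]
      have h2 := hspan _ h1
      rw [Representation.IntertwiningMap.mem_ker] at h2
      rw [map_smul, h2, smul_zero] at hv0
      exact hv0 rfl

end Transfer

section Coefficients

open MvPolynomial

variable {n : ℕ}

/-- A polynomial which is antisymmetric in the variables of each block of `F`. -/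
def SwapAnti (F : Fin n → ℕ) (g : MvPolynomial (Fin n) ℂ) : Prop :=
  ∀ i j, F i = F j → i ≠ j → ∀ e, coeff (e.mapDomain (Equiv.swap i j)) g = -coeff e g

lemma mapDomain_swap_apply (i j k : Fin n) (e : Fin n →₀ ℕ) :
    e.mapDomain (Equiv.swap i j) k = e (Equiv.swap i j k) := by
  rw [Finsupp.mapDomain_equiv_apply, Equiv.symm_swap]

lemma mapDomain_swap_swap (i j : Fin n) (e : Fin n →₀ ℕ) :
    (e.mapDomain (Equiv.swap i j)).mapDomain (Equiv.swap i j) = e := by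
  ext k
  rw [mapDomain_swap_apply, mapDomain_swap_apply, Equiv.swap_apply_self]

lemma matAct_dsw (i j : Fin n) (g : MvPolynomial (Fin n) ℂ) :
    matAct (Mrefl (dsw i j)) g = rename (Equiv.swap i j) g := by
  refine DFunLike.congr_fun (MvPolynomial.algHom_ext fun k => ?_ :
    matAct (Mrefl (dsw i j)) = rename (Equiv.swap i j)) g
  simp [matAct_X, linForm, Mrefl_apply, dsw_inl, signedCoord_inl]

lemma coeff_matAct_dsw (i j : Fin n) (g : MvPolynomial (Fin n) ℂ) (e : Fin n →₀ ℕ) :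
    coeff e (matAct (Mrefl (dsw i j)) g) = coeff (e.mapDomain (Equiv.swap i j)) g := by
  rw [matAct_dsw, ← coeff_rename_mapDomain (Equiv.swap i j) (Equiv.injective _) g,
    mapDomain_swap_swap]

lemma Mrefl_ssw (i : Fin n) :
    Mrefl (ssw i) = Matrix.diagonal fun k => if k = i then (-1 : ℂ) else 1 := by
  ext j k
  simp only [Mrefl_apply, ssw, Equiv.swap_apply_def, Matrix.diagonal_apply]
  rcases eq_or_ne k i with rfl | h
  · rw [if_pos rfl, signedCoord_inr]
    rcases eq_or_ne k j with rfl | h'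
    · simp
    · simp [h', h'.symm]
  · rw [if_neg (by simpa using h), if_neg (by simp), signedCoord_inl]
    rcases eq_or_ne k j with rfl | h'
    · simp [h]
    · simp [h', h'.symm]

lemma Mrefl_dsw (i j : Fin n) : Mrefl (dsw i j) = (Equiv.swap i j).permMatrix ℂ := by
  ext k l
  rw [Mrefl_apply, dsw_inl, signedCoord_inl, Equiv.Perm.permMatrix, PEquiv.toMatrix_apply]
  simp only [Equiv.toPEquiv_apply, Option.mem_some_iff]
  exact if_congr (by rw [Equiv.swap_apply_eq_iff, eq_comm]) rfl rfl

lemma sgnChar_ssw (i : Fin n) : sgnChar (ssw i) = -1 := by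
  rw [sgnChar, Mrefl_ssw, Matrix.det_diagonal]
  simp

lemma sgnChar_dsw {i j : Fin n} (h : i ≠ j) : sgnChar (dsw i j) = -1 := by
  rw [sgnChar, Mrefl_dsw, Matrix.det_permutation, Equiv.Perm.sign_swap h]
  simp

lemma dsw_self (i : Fin n) : dsw i i = 1 := by
  rw [dsw, Equiv.swap_self, Equiv.swap_self]
  rfl

lemma sgnChar_one : sgnChar (1 : PG n) = 1 := by
  rw [sgnChar, Mrefl_one, Matrix.det_one]

lemma sgnChar_mul {π τ : PG n} (h : IsSigned π) : sgnChar (π * τ) = sgnChar π * sgnChar τ := by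
  rw [sgnChar, Mrefl_mul h, Matrix.det_mul]
  rfl

lemma sgnChar_msw {i j : Fin n} (h : i ≠ j) : sgnChar (msw i j) = -1 := by
  rw [msw_eq h, sgnChar_mul (isSigned_ssw i), sgnChar_mul (isSigned_ssw j), sgnChar_ssw,
    sgnChar_ssw, sgnChar_dsw h]
  norm_num

lemma matAct_ssw_monomial (i : Fin n) (e : Fin n →₀ ℕ) (a : ℂ) :
    matAct (Mrefl (ssw i)) (monomial e a) = monomial e ((-1) ^ e i * a) := by
  have hX : ∀ k, linForm (fun j => Mrefl (ssw i) j k) =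
      C (if k = i then (-1 : ℂ) else 1) * X k := fun k => by
    rw [linForm, Mrefl_ssw, Finset.sum_eq_single k (fun j _ hj => by
      rw [Matrix.diagonal_apply_ne _ hj, C_0, zero_mul]) (by simp), Matrix.diagonal_apply_eq]
  rw [matAct, aeval_monomial, monomial_eq (s := e),
    Finsupp.prod_fintype _ _ (fun _ => pow_zero _), Finsupp.prod_fintype _ _ (fun _ => pow_zero _),
    Finset.prod_congr rfl fun k _ => by rw [hX, mul_pow], Finset.prod_mul_distrib, ← mul_assoc]
  congr 1
  rw [Finset.prod_eq_single i (fun k _ hk => by simp [hk]) (by simp), if_pos rfl, C_mul, C_pow,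
    mul_comm]
  rfl

lemma coeff_matAct_ssw (i : Fin n) (g : MvPolynomial (Fin n) ℂ) (e : Fin n →₀ ℕ) :
    coeff e (matAct (Mrefl (ssw i)) g) = (-1) ^ e i * coeff e g := by
  induction g using MvPolynomial.induction_on' with
  | monomial u a =>
    rw [matAct_ssw_monomial, coeff_monomial, coeff_monomial]
    split_ifs with h
    · rw [h]
    · rw [mul_zero]
  | add p q hp hq => rw [map_add, coeff_add, coeff_add, hp, hq, mul_add]

lemma coeff_matAct_msw {i j : Fin n} (h : i ≠ j) (g : MvPolynomial (Fin n) ℂ) (e : Fin n →₀ ℕ) :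
    coeff e (matAct (Mrefl (msw i j)) g) =
      (-1) ^ (e i + e j) * coeff (e.mapDomain (Equiv.swap i j)) g := by
  rw [msw_eq h, Mrefl_mul (isSigned_ssw i), Mrefl_mul (isSigned_ssw j), matAct_mul, matAct_mul,
    AlgHom.comp_apply, AlgHom.comp_apply, coeff_matAct_ssw, coeff_matAct_ssw, coeff_matAct_dsw,
    pow_add, mul_assoc]

lemma neg_one_pow_mul_eq_iff {m : ℕ} {c : ℂ} : (-1) ^ m * c = -c ↔ c ≠ 0 → Odd m := by
  rcases Nat.even_or_odd m with h | h
  · rw [h.neg_one_pow, one_mul, self_eq_neg]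
    rw [← Nat.not_even_iff_odd]
    tauto
  · rw [h.neg_one_pow, neg_one_mul]
    simp [h]

lemma mem_antiSpace_blkSub {F : Fin n → ℕ} {ty : Fin n → BTy} {d : ℕ} {g : HPoly n d} :
    g ∈ antiSpace (blkSub_le_BWn F ty) d ↔
      SwapAnti F g ∧
      (∀ i, ty i = BTy.B → ∀ e, coeff e (g : MvPolynomial (Fin n) ℂ) ≠ 0 → Odd (e i)) ∧
      (∀ i j, F i = F j → ty i = BTy.D → ty j = BTy.D →
        ∀ e, coeff e (g : MvPolynomial (Fin n) ℂ) ≠ 0 → Even (e i + e j)) := by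
  have key : g ∈ antiSpace (blkSub_le_BWn F ty) d ↔
      ∀ π ∈ blkSub n F ty, matAct (Mrefl π) g = sgnChar π • (g : MvPolynomial (Fin n) ℂ) :=
    ⟨fun h π hπ => congrArg Subtype.val (h ⟨π, hπ⟩), fun h π => Subtype.ext (h π π.2)⟩
  rw [key]
  constructor
  · intro h
    have hsw : SwapAnti F g := fun i j hij hne e => by
      rw [← coeff_matAct_dsw, h _ (Subgroup.subset_closure (Or.inl (Or.inl ⟨i, j, hij, rfl⟩))),
        sgnChar_dsw hne, neg_one_smul, coeff_neg]
    refine ⟨hsw, fun i hi e => ?_, fun i j hij hi hj e he => ?_⟩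
    · rw [← neg_one_pow_mul_eq_iff, ← coeff_matAct_ssw,
        h _ (Subgroup.subset_closure (Or.inl (Or.inr ⟨i, hi, rfl⟩))), sgnChar_ssw, neg_one_smul,
        coeff_neg]
    · rcases eq_or_ne i j with rfl | hne
      · exact Even.add_self _
      · have h1 := congrArg (coeff e)
          (h _ (Subgroup.subset_closure (Or.inr ⟨i, j, hij, hi, hj, rfl⟩)))
        rw [coeff_matAct_msw hne, hsw i j hij hne, sgnChar_msw hne, neg_one_smul, coeff_neg] at h1
        by_contra hodd
        rw [Nat.not_even_iff_odd] at hodd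
        rw [hodd.neg_one_pow, neg_one_mul, neg_neg, self_eq_neg] at h1
        exact he h1
  · rintro ⟨h1, h2, h3⟩ π hπ
    refine Subgroup.closure_induction (p := fun π _ => IsSigned π ∧ matAct (Mrefl π) g =
      sgnChar π • (g : MvPolynomial (Fin n) ℂ)) ?_ ?_ ?_ ?_ hπ |>.2
    · rintro π ((⟨i, j, hij, rfl⟩ | ⟨i, hi, rfl⟩) | ⟨i, j, hij, hi, hj, rfl⟩)
      · refine ⟨isSigned_dsw i j, ?_⟩
        rcases eq_or_ne i j with rfl | hne
        · rw [dsw_self, Mrefl_one, matAct_one, sgnChar_one, one_smul]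
          rfl
        · ext e
          rw [coeff_matAct_dsw, h1 i j hij hne, sgnChar_dsw hne, neg_one_smul, coeff_neg]
      · refine ⟨isSigned_ssw i, ?_⟩
        ext e
        rw [coeff_matAct_ssw, sgnChar_ssw, neg_one_smul, coeff_neg, neg_one_pow_mul_eq_iff]
        exact h2 i hi e
      · rcases eq_or_ne i j with rfl | hne
        · rw [msw_self, Mrefl_one, matAct_one, sgnChar_one, one_smul]
          exact ⟨IsSigned.one, rfl⟩
        · refine ⟨isSigned_of_mem_BWn (msw_mem_BWn i j), ?_⟩
          ext e
          rw [coeff_matAct_msw hne, h1 i j hij hne, sgnChar_msw hne, neg_one_smul, coeff_neg]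
          rcases eq_or_ne (coeff e (g : MvPolynomial (Fin n) ℂ)) 0 with h0 | h0
          · rw [h0, neg_zero, mul_zero]
          · rw [(h3 i j hij hi hj e h0).neg_one_pow, one_mul]
    · refine ⟨IsSigned.one, ?_⟩
      rw [Mrefl_one, matAct_one, sgnChar_one, one_smul]
      rfl
    · rintro x y - - ⟨hx, hx'⟩ ⟨hy, hy'⟩
      refine ⟨hx.mul hy, ?_⟩
      rw [Mrefl_mul hx, matAct_mul, AlgHom.comp_apply, hy', map_smul, hx', smul_smul,
        sgnChar_mul hx, mul_comm]
    · rintro x - ⟨hx, hx'⟩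
      refine ⟨hx.inv, ?_⟩
      have h4 : sgnChar x⁻¹ * sgnChar x = 1 := by
        rw [← sgnChar_mul hx.inv, inv_mul_cancel, sgnChar_one]
      have h5 : matAct (Mrefl x⁻¹) (matAct (Mrefl x) (g : MvPolynomial (Fin n) ℂ)) = g := by
        rw [← AlgHom.comp_apply, ← matAct_mul, ← Mrefl_mul hx.inv, inv_mul_cancel, Mrefl_one,
          matAct_one]
        rfl
      rw [hx', map_smul] at h5
      rw [← one_smul ℂ (matAct _ _), ← h4, mul_smul, h5]

lemma sum_eq_of_coeff_ne_zero {d : ℕ} (g : HPoly n d) {e : Fin n →₀ ℕ}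
    (h : coeff e (g : MvPolynomial (Fin n) ℂ) ≠ 0) : ∑ i, e i = d := by
  rw [← Finsupp.degree_eq_sum, Finsupp.degree_eq_weight_one]
  exact g.2 h

lemma SwapAnti.injOn {F : Fin n → ℕ} {g : MvPolynomial (Fin n) ℂ} (hg : SwapAnti F g)
    {e : Fin n →₀ ℕ} (he : coeff e g ≠ 0) {i j : Fin n} (hF : F i = F j) (h : e i = e j) :
    i = j := by
  by_contra hne
  have h1 := hg i j hF hne e
  have h2 : e.mapDomain (Equiv.swap i j) = e := by
    ext k
    rw [mapDomain_swap_apply, Equiv.swap_apply_def]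
    grind
  rw [h2, self_eq_neg] at h1
  exact he h1

/-- Block-antisymmetric polynomials are determined up to a scalar on the exponents obtained from
`e₀` by permutations within the blocks. -/
lemma SwapAnti.coeff_mul_coeff {F : Fin n → ℕ} {f g : MvPolynomial (Fin n) ℂ} (hf : SwapAnti F f)
    (hg : SwapAnti F g) {e₀ : Fin n →₀ ℕ} (h₀ : ∀ i j, F i = F j → e₀ i = e₀ j → i = j)
    (e : Fin n →₀ ℕ) (he : ∀ i, ∃ j, F j = F i ∧ e j = e₀ i) :
    coeff e₀ g * coeff e f = coeff e₀ f * coeff e g := by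
  induction hm : (Finset.univ.filter fun i => e i ≠ e₀ i).card using Nat.strong_induction_on
    generalizing e with
  | _ m ih =>
    by_cases hee : e = e₀
    · rw [hee, mul_comm]
    · obtain ⟨i, hi⟩ := DFunLike.ne_iff.1 hee
      obtain ⟨j, hj, hj'⟩ := he i
      have hne : i ≠ j := by
        rintro rfl
        exact hi hj'
      have := ih _ ?_ (e.mapDomain (Equiv.swap i j)) ?_ rfl
      · rwa [hf i j hj.symm hne, hg i j hj.symm hne, mul_neg, mul_neg, neg_inj] at this
      · rw [← hm]
        refine Finset.card_lt_card (Finset.ssubset_iff_of_subset ?_ |>.2 ⟨i, ?_, ?_⟩)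
        · intro k
          simp only [Finset.mem_filter, Finset.mem_univ, true_and, mapDomain_swap_apply]
          have := h₀ i j hj.symm
          rw [Equiv.swap_apply_def]
          grind
        · simpa using hi
        · simp [hj']
      · intro k
        obtain ⟨l, hl, hl'⟩ := he k
        refine ⟨Equiv.swap i j l, ?_, ?_⟩
        · rw [← hl, Equiv.swap_apply_def]
          grind
        · rw [mapDomain_swap_apply, Equiv.swap_apply_self, hl']

lemma isLowest_blkSub {F : Fin n → ℕ} {ty : Fin n → BTy} {N : ℕ} {f : HPoly n N}
    (hf : f ∈ antiSpace (blkSub_le_BWn F ty) N) {e₀ : Fin n →₀ ℕ}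
    (hc : coeff e₀ (f : MvPolynomial (Fin n) ℂ) ≠ 0)
    (hmin : ∀ (d : ℕ) (g : HPoly n d), g ∈ antiSpace (blkSub_le_BWn F ty) d →
      ∀ e, coeff e (g : MvPolynomial (Fin n) ℂ) ≠ 0 →
        ∑ i, e₀ i ≤ ∑ i, e i ∧ (∑ i, e₀ i = ∑ i, e i → ∀ i, ∃ j, F j = F i ∧ e j = e₀ i)) :
    IsLowest (blkSub_le_BWn F ty) f := by
  have hN := sum_eq_of_coeff_ne_zero f hc
  have hf' := (mem_antiSpace_blkSub.1 hf).1
  refine ⟨?_, hf, fun g hg => ?_, fun d hd => ?_⟩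
  · rintro rfl
    exact hc (coeff_zero _)
  · refine ⟨coeff e₀ (g : MvPolynomial (Fin n) ℂ) / coeff e₀ (f : MvPolynomial (Fin n) ℂ),
      Subtype.ext ?_⟩
    ext e
    rw [Submodule.coe_smul, coeff_smul, smul_eq_mul, div_mul_eq_mul_div, div_eq_iff hc,
      mul_comm (coeff e _) (coeff e₀ _)]
    have hg' := (mem_antiSpace_blkSub.1 hg).1
    by_cases h1 : coeff e (f : MvPolynomial (Fin n) ℂ) = 0 ∧
        coeff e (g : MvPolynomial (Fin n) ℂ) = 0
    · rw [h1.1, h1.2, mul_zero, mul_zero]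
    · refine hf'.coeff_mul_coeff hg' (fun i j => hf'.injOn hc) e ?_
      rw [not_and_or] at h1
      rcases h1 with h1 | h1
      · exact (hmin N f hf e h1).2 (hN.trans (sum_eq_of_coeff_ne_zero f h1).symm)
      · exact (hmin N g hg e h1).2 (hN.trans (sum_eq_of_coeff_ne_zero g h1).symm)
  · rw [Submodule.eq_bot_iff]
    intro g hg
    refine Subtype.ext ?_
    ext e
    by_contra h
    have h1 := (hmin d g hg e h).1
    rw [hN, sum_eq_of_coeff_ne_zero g h] at h1
    omega

end Coefficients

section Minimality

/-- Among families of distinct naturals indexed by `s`, one filling (the relevant part of) an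
initial segment has the smallest sum, and minimality of the sum determines the image. -/
lemma sum_le_sum_of_initial {ι : Type*} {s : Finset ι} {e e₀ : ι → ℕ} (he : Set.InjOn e s)
    (he₀ : Set.InjOn e₀ s) {M : ℕ} (h₀ : ∀ i ∈ s, e₀ i < M)
    (h : ∀ i ∈ s, e i < M → ∃ j ∈ s, e₀ j = e i) :
    ∑ i ∈ s, e₀ i ≤ ∑ i ∈ s, e i ∧
      (∑ i ∈ s, e₀ i = ∑ i ∈ s, e i → ∀ i ∈ s, ∃ j ∈ s, e j = e₀ i) := by
  classical
  set A := s.image e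
  set B := s.image e₀
  have hA : ∑ x ∈ A, x = ∑ i ∈ s, e i := Finset.sum_image he
  have hB : ∑ x ∈ B, x = ∑ i ∈ s, e₀ i := Finset.sum_image he₀
  have hcard : (A \ B).card = (B \ A).card := by
    refine Finset.card_sdiff_comm ?_
    rw [Finset.card_image_of_injOn he, Finset.card_image_of_injOn he₀]
  have h1 : (A \ B).card * M ≤ ∑ x ∈ A \ B, x := by
    rw [← smul_eq_mul]
    refine Finset.card_nsmul_le_sum _ _ _ fun x hx => ?_
    by_contra! hlt
    obtain ⟨hxA, hxB⟩ := Finset.mem_sdiff.1 hx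
    obtain ⟨i, hi, rfl⟩ := Finset.mem_image.1 hxA
    obtain ⟨j, hj, hj'⟩ := h i hi hlt
    exact hxB (Finset.mem_image.2 ⟨j, hj, hj'⟩)
  have h2 : ∑ x ∈ B \ A, (x + 1) ≤ (B \ A).card * M := by
    rw [← smul_eq_mul]
    refine Finset.sum_le_card_nsmul _ _ _ fun x hx => ?_
    obtain ⟨i, hi, rfl⟩ := Finset.mem_image.1 (Finset.mem_sdiff.1 hx).1
    exact h₀ i hi
  rw [Finset.sum_add_distrib, Finset.sum_const, smul_eq_mul, mul_one, ← hcard] at h2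
  have h3 := Finset.sum_inter_add_sum_sdiff A B (fun x => x)
  have h4 := Finset.sum_inter_add_sum_sdiff B A (fun x => x)
  rw [Finset.inter_comm] at h4
  refine ⟨by omega, fun heq i hi => ?_⟩
  have h5 : B \ A = ∅ := by
    rw [← Finset.card_eq_zero]
    omega
  have h6 := Finset.sdiff_eq_empty_iff_subset.1 h5 (Finset.mem_image_of_mem e₀ hi)
  exact Finset.mem_image.1 h6

lemma sum_le_sum_of_blocks {ι : Type*} [Fintype ι] {F e e₀ : ι → ℕ}
    (h : ∀ b, ∑ i with F i = b, e₀ i ≤ ∑ i with F i = b, e i ∧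
      (∑ i with F i = b, e₀ i = ∑ i with F i = b, e i →
        ∀ i ∈ Finset.univ.filter (F · = b), ∃ j ∈ Finset.univ.filter (F · = b), e j = e₀ i)) :
    ∑ i, e₀ i ≤ ∑ i, e i ∧ (∑ i, e₀ i = ∑ i, e i → ∀ i, ∃ j, F j = F i ∧ e j = e₀ i) := by
  classical
  have hF : ∀ i ∈ Finset.univ, F i ∈ Finset.univ.image F := fun i hi =>
    Finset.mem_image_of_mem F hi
  rw [← Finset.sum_fiberwise_of_maps_to hF e, ← Finset.sum_fiberwise_of_maps_to hF e₀]
  refine ⟨Finset.sum_le_sum fun b _ => (h b).1, fun heq i => ?_⟩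
  rw [Finset.sum_eq_sum_iff_of_le fun b _ => (h b).1] at heq
  obtain ⟨j, hj, hj'⟩ := (h (F i)).2 (heq _ (hF i (Finset.mem_univ i))) i (by simp)
  exact ⟨j, by simpa using hj, hj'⟩

end Minimality

section Adapted

open MvPolynomial

variable {n : ℕ}

/-- The block structure `F₂` splits the top block `K` of `F₁` into a part of type `B` and one of
type `D`; the exponents `e₀` enumerate an initial segment on every block of `F₁`, being odd on the
`B`-part and even on the `D`-part of the top block. -/
structure Adapted (F₁ F₂ : Fin n → ℕ) (ty : Fin n → BTy) (K : ℕ) (e₀ : Fin n →₀ ℕ) : Prop where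
  le : ∀ i, F₁ i ≤ K
  of_lt : ∀ i, F₁ i < K → F₂ i = F₁ i
  of_eq : ∀ i, F₁ i = K → F₂ i = K ∨ F₂ i = K + 1
  ty_S : ∀ i, F₂ i < K → ty i = BTy.S
  ty_B : ∀ i, F₂ i = K → ty i = BTy.B
  ty_D : ∀ i, F₂ i = K + 1 → ty i = BTy.D
  inj : ∀ i j, F₁ i = F₁ j → e₀ i = e₀ j → i = j
  odd : ∀ i, F₂ i = K → Odd (e₀ i)
  even : ∀ i, F₂ i = K + 1 → Even (e₀ i)
  full : ∀ b, ∃ M, (∀ i, F₁ i = b → e₀ i < M) ∧ ∀ v < M, ∃ j, F₁ j = b ∧ e₀ j = v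

namespace Adapted

variable {F₁ F₂ : Fin n → ℕ} {ty : Fin n → BTy} {K : ℕ} {e₀ : Fin n →₀ ℕ}

lemma fst_eq (h : Adapted F₁ F₂ ty K e₀) {i j : Fin n} (hij : F₂ i = F₂ j) : F₁ i = F₁ j := by
  have := h.le i
  have := h.le j
  have := h.of_lt i
  have := h.of_lt j
  have := h.of_eq i
  have := h.of_eq j
  omega

lemma minimal₁ (h : Adapted F₁ F₂ ty K e₀) {d : ℕ} {g : HPoly n d}
    (hg : g ∈ antiSpace (blkSub_le_BWn F₁ fun _ => BTy.S) d) {e : Fin n →₀ ℕ}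
    (he : coeff e (g : MvPolynomial (Fin n) ℂ) ≠ 0) :
    ∑ i, e₀ i ≤ ∑ i, e i ∧ (∑ i, e₀ i = ∑ i, e i → ∀ i, ∃ j, F₁ j = F₁ i ∧ e j = e₀ i) := by
  have hanti := (mem_antiSpace_blkSub.1 hg).1
  refine sum_le_sum_of_blocks fun b => ?_
  obtain ⟨M, hM, hM'⟩ := h.full b
  refine sum_le_sum_of_initial (M := M) ?_ ?_ (by simpa using hM) ?_
  · intro i hi j hj hij
    simp only [Finset.coe_filter, Finset.mem_univ, true_and, Set.mem_ofPred_eq] at hi hj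
    exact hanti.injOn he (hi.trans hj.symm) hij
  · intro i hi j hj hij
    simp only [Finset.coe_filter, Finset.mem_univ, true_and, Set.mem_ofPred_eq] at hi hj
    exact h.inj i j (hi.trans hj.symm) hij
  · intro i _ hlt
    simpa using hM' _ hlt

lemma minimal₂ (h : Adapted F₁ F₂ ty K e₀) {d : ℕ} {g : HPoly n d}
    (hg : g ∈ antiSpace (blkSub_le_BWn F₂ ty) d) {e : Fin n →₀ ℕ}
    (he : coeff e (g : MvPolynomial (Fin n) ℂ) ≠ 0) :
    ∑ i, e₀ i ≤ ∑ i, e i ∧ (∑ i, e₀ i = ∑ i, e i → ∀ i, ∃ j, F₂ j = F₂ i ∧ e j = e₀ i) := by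
  obtain ⟨hanti, hB, hD⟩ := mem_antiSpace_blkSub.1 hg
  have hinj₀ : ∀ b, Set.InjOn e₀ (Finset.univ.filter (F₂ · = b)) := fun b i hi j hj hij => by
    simp only [Finset.coe_filter, Finset.mem_univ, true_and, Set.mem_ofPred_eq] at hi hj
    exact h.inj i j (h.fst_eq (hi.trans hj.symm)) hij
  have hinj : ∀ b, Set.InjOn e (Finset.univ.filter (F₂ · = b)) := fun b i hi j hj hij => by
    simp only [Finset.coe_filter, Finset.mem_univ, true_and, Set.mem_ofPred_eq] at hi hj
    exact hanti.injOn he (hi.trans hj.symm) hij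
  refine sum_le_sum_of_blocks fun b => ?_
  rcases lt_trichotomy b K with hb | rfl | hb
  · have hF : ∀ i, F₂ i = b ↔ F₁ i = b := fun i => by
      have := h.le i
      have := h.of_lt i
      have := h.of_eq i
      omega
    obtain ⟨M, hM, hM'⟩ := h.full b
    refine sum_le_sum_of_initial (M := M) (hinj b) (hinj₀ b) ?_ ?_
    · simpa [hF] using hM
    · intro i _ hlt
      simpa [hF] using hM' _ hlt
  · have hF : ∀ i, F₂ i = b → F₁ i = b := fun i => by
      have := h.le i
      have := h.of_lt i
      omega
    obtain ⟨M, hM, hM'⟩ := h.full b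
    refine sum_le_sum_of_initial (M := M) (hinj b) (hinj₀ b) ?_ ?_
    · intro i hi
      exact hM i (hF i (by simpa using hi))
    · intro i hi hlt
      obtain ⟨j, hj, hj'⟩ := hM' _ hlt
      have hodd := hB i (h.ty_B i (by simpa using hi)) e he
      refine ⟨j, ?_, hj'⟩
      rw [Finset.mem_filter]
      refine ⟨Finset.mem_univ j, (h.of_eq j hj).resolve_right fun hj2 => ?_⟩
      have := h.even j hj2
      rw [hj', ← Nat.not_odd_iff_even] at this
      exact this hodd
  · obtain rfl | hb := eq_or_lt_of_le (Nat.succ_le_of_lt hb)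
    · have hF : ∀ i, F₂ i = K + 1 → F₁ i = K := fun i => by
        have := h.le i
        have := h.of_lt i
        omega
      obtain ⟨M, hM, hM'⟩ := h.full K
      have hpar : ∀ i j, F₂ i = K + 1 → F₂ j = K + 1 → Even (e i + e j) := fun i j hi hj =>
        hD i j (hi.trans hj.symm) (h.ty_D i hi) (h.ty_D j hj) e he
      have key := sum_le_sum_of_initial (s := Finset.univ.filter (F₂ · = K + 1)) (M := M)
        (e := fun i => 2 * (e i / 2)) (e₀ := e₀) ?_ (hinj₀ _) ?_ ?_
      · have hle : ∑ i with F₂ i = K + 1, 2 * (e i / 2) ≤ ∑ i with F₂ i = K + 1, e i :=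
          Finset.sum_le_sum fun i _ => Nat.mul_div_le (e i) 2
        refine ⟨key.1.trans hle, fun heq i hi => ?_⟩
        have heq' := le_antisymm key.1 (hle.trans heq.ge)
        obtain ⟨j, hj, hj'⟩ := key.2 heq' i hi
        have := (Finset.sum_eq_sum_iff_of_le fun i _ => Nat.mul_div_le (e i) 2).1
          (heq'.symm.trans heq) j hj
        exact ⟨j, hj, this.symm.trans hj'⟩
      · intro i hi j hj hij
        refine hinj (K + 1) hi hj ?_
        simp only [Finset.coe_filter, Finset.mem_univ, true_and, Set.mem_ofPred_eq] at hi hj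
        have := hpar i j hi hj
        rw [Nat.even_iff] at this
        simp only at hij
        omega
      · intro i hi
        exact hM i (hF i (by simpa using hi))
      · intro i hi hlt
        obtain ⟨j, hj, hj'⟩ := hM' _ hlt
        refine ⟨j, ?_, hj'⟩
        rw [Finset.mem_filter]
        refine ⟨Finset.mem_univ j, (h.of_eq j hj).resolve_left fun hj2 => ?_⟩
        have := h.odd j hj2
        rw [hj', ← Nat.not_even_iff_odd] at this
        exact this (even_two_mul _)
    · have hempty : Finset.univ.filter (F₂ · = b) = ∅ := by
        rw [Finset.filter_eq_empty_iff]
        intro i _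
        have := h.le i
        have := h.of_lt i
        have := h.of_eq i
        omega
      simp [hempty]

end Adapted

/-- The antisymmetrization over the blocks of `F` of the monomial with exponent `e₀`. -/
def blockAlt (F : Fin n → ℕ) (e₀ : Fin n →₀ ℕ) : MvPolynomial (Fin n) ℂ :=
  ∑ τ : Equiv.Perm (Fin n) with (∀ i, F (τ i) = F i),
    monomial (Finsupp.equivFunOnFinite.symm (e₀ ∘ τ)) ((Equiv.Perm.sign τ : ℤ) : ℂ)

lemma isHomogeneous_blockAlt (F : Fin n → ℕ) (e₀ : Fin n →₀ ℕ) :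
    (blockAlt F e₀).IsHomogeneous (∑ i, e₀ i) := by
  refine IsHomogeneous.sum _ _ _ fun τ _ => isHomogeneous_monomial _ ?_
  rw [Finsupp.degree_eq_sum, ← Equiv.sum_comp τ e₀]
  rfl

lemma coeff_blockAlt (F : Fin n → ℕ) (e₀ e : Fin n →₀ ℕ) :
    coeff e (blockAlt F e₀) = ∑ τ : Equiv.Perm (Fin n),
      if (∀ i, F (τ i) = F i) ∧ ∀ i, e₀ (τ i) = e i then ((Equiv.Perm.sign τ : ℤ) : ℂ) else 0 := by
  rw [blockAlt, coeff_sum, Finset.sum_filter]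
  refine Finset.sum_congr rfl fun τ _ => ?_
  rw [coeff_monomial, ← ite_and]
  refine if_congr (and_congr_right fun _ => ?_) rfl rfl
  rw [DFunLike.ext_iff]
  rfl

lemma swapAnti_blockAlt (F : Fin n → ℕ) (e₀ : Fin n →₀ ℕ) : SwapAnti F (blockAlt F e₀) := by
  intro i j hij hne e
  have hF : ∀ k, F (Equiv.swap i j k) = F k := fun k => by
    rw [Equiv.swap_apply_def]
    grind
  rw [coeff_blockAlt, coeff_blockAlt, ← Equiv.sum_comp (Equiv.mulRight (Equiv.swap i j)),
    ← Finset.sum_neg_distrib]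
  refine Finset.sum_congr rfl fun τ _ => ?_
  have h1 : (∀ k, F (τ (Equiv.swap i j k)) = F k) ↔ ∀ k, F (τ k) = F k :=
    ⟨fun h k => by simpa [hF] using h (Equiv.swap i j k), fun h k => by rw [h, hF]⟩
  have h2 : (∀ k, e₀ (τ (Equiv.swap i j k)) = e (Equiv.swap i j k)) ↔ ∀ k, e₀ (τ k) = e k :=
    ⟨fun h k => by simpa using h (Equiv.swap i j k), fun h k => h _⟩
  simp only [Equiv.coe_mulRight, Equiv.Perm.mul_apply, mapDomain_swap_apply, h1, h2,
    Equiv.Perm.sign_mul, Equiv.Perm.sign_swap hne]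
  split_ifs <;> simp

lemma coeff_blockAlt_self {F : Fin n → ℕ} {e₀ : Fin n →₀ ℕ}
    (h : ∀ i j, F i = F j → e₀ i = e₀ j → i = j) : coeff e₀ (blockAlt F e₀) = 1 := by
  rw [coeff_blockAlt, Finset.sum_eq_single 1]
  · simp
  · intro τ _ hτ
    rw [if_neg]
    rintro ⟨h1, h2⟩
    exact hτ (Equiv.ext fun i => h _ _ (h1 i) (h2 i))
  · simp

/-- Subrepresentations of polynomials are stable under projection to prescribed parities. -/
lemma exists_parity_mem {N : ℕ} (U : Subrepresentation (polyRep n N)) {f : HPoly n N} (hf : f ∈ U)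
    (e₀ : Fin n →₀ ℕ) (T : Finset (Fin n)) :
    ∃ f' ∈ U, ∀ e, coeff e (f' : MvPolynomial (Fin n) ℂ) =
      if ∀ i ∈ T, (Even (e i) ↔ Even (e₀ i)) then coeff e (f : MvPolynomial (Fin n) ℂ) else 0 := by
  classical
  induction T using Finset.induction_on with
  | empty => exact ⟨f, hf, fun e => by simp⟩
  | insert i T _ ih =>
    obtain ⟨f', hf', hc⟩ := ih
    refine ⟨(2 : ℂ)⁻¹ • (f' + (-1 : ℂ) ^ e₀ i • polyRep n N ⟨ssw i, ssw_mem_BWn i⟩ f'),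
      U.toSubmodule.smul_mem _ (U.toSubmodule.add_mem hf'
        (U.toSubmodule.smul_mem _ (U.apply_mem_toSubmodule _ hf'))), fun e => ?_⟩
    have : coeff e (((2 : ℂ)⁻¹ • (f' + (-1 : ℂ) ^ e₀ i • polyRep n N ⟨ssw i, ssw_mem_BWn i⟩ f') :
        HPoly n N) : MvPolynomial (Fin n) ℂ) =
        2⁻¹ * (1 + (-1) ^ e₀ i * (-1) ^ e i) * coeff e (f' : MvPolynomial (Fin n) ℂ) := by
      rw [Submodule.coe_smul, Submodule.coe_add, Submodule.coe_smul, coe_polyRep, coeff_smul,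
        coeff_add, coeff_smul, coeff_matAct_ssw, smul_eq_mul, smul_eq_mul]
      ring
    simp only [this, hc, Finset.forall_mem_insert, ite_and]
    rcases Nat.even_or_odd (e i) with h1 | h1 <;> rcases Nat.even_or_odd (e₀ i) with h2 | h2 <;>
      simp only [h1.neg_one_pow, h2.neg_one_pow, h1, h2, Nat.not_even_iff_odd.2]
    all_goals norm_num

theorem Adapted.isJInd_iff {F₁ F₂ : Fin n → ℕ} {ty : Fin n → BTy} {K : ℕ} {e₀ : Fin n →₀ ℕ}
    (h : Adapted F₁ F₂ ty K e₀) (χ : BWn n → ℂ) :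
    IsJInd reflChar (blkSub n F₁ fun _ => BTy.S) (BWn n) (resChar _ sgnChar) χ ↔
      IsJInd reflChar (blkSub n F₂ ty) (BWn n) (resChar _ sgnChar) χ := by
  classical
  let f₁ : HPoly n (∑ i, e₀ i) := ⟨blockAlt F₁ e₀, isHomogeneous_blockAlt F₁ e₀⟩
  let T : Finset (Fin n) := Finset.univ.filter fun i => K ≤ F₂ i
  obtain ⟨f₂, -, hf₂⟩ := exists_parity_mem ⊤ (f := f₁) trivial e₀ T
  have hc₁ : coeff e₀ (f₁ : MvPolynomial (Fin n) ℂ) = 1 := coeff_blockAlt_self h.inj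
  have hc₂ : coeff e₀ (f₂ : MvPolynomial (Fin n) ℂ) = 1 := by
    rw [hf₂, if_pos fun _ _ => Iff.rfl, hc₁]
  have hm₁ : f₁ ∈ antiSpace (blkSub_le_BWn F₁ fun _ => BTy.S) _ :=
    mem_antiSpace_blkSub.2 ⟨swapAnti_blockAlt F₁ e₀, by simp, by simp⟩
  have hpar : ∀ e, coeff e (f₂ : MvPolynomial (Fin n) ℂ) ≠ 0 → ∀ i, K ≤ F₂ i →
      (Even (e i) ↔ Even (e₀ i)) := fun e he i hi => by
    rw [hf₂] at he
    exact (ite_ne_right_iff.1 he).1 i (by simpa [T] using hi)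
  have hpar₀ : ∀ i j, K ≤ F₂ i → F₂ i = F₂ j → (Even (e₀ i) ↔ Even (e₀ j)) := fun i j hi hij => by
    have := h.le i
    have := h.of_lt i
    have := h.of_eq i
    obtain hK | hK : F₂ i = K ∨ F₂ i = K + 1 := by omega
    · simp [Nat.not_even_iff_odd.2 (h.odd i hK), Nat.not_even_iff_odd.2 (h.odd j (hij ▸ hK))]
    · simp [h.even i hK, h.even j (hij ▸ hK)]
  have hm₂ : f₂ ∈ antiSpace (blkSub_le_BWn F₂ ty) _ := by
    refine mem_antiSpace_blkSub.2 ⟨fun i j hij hne e => ?_, fun i hi e he => ?_,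
      fun i j hij hi hj e he => ?_⟩
    · rw [hf₂, hf₂, swapAnti_blockAlt F₁ e₀ i j (h.fst_eq hij) hne e]
      have hF : ∀ k, F₂ (Equiv.swap i j k) = F₂ k := fun k => by
        rw [Equiv.swap_apply_def]
        grind
      have hiff : (∀ k ∈ T, (Even (e.mapDomain (Equiv.swap i j) k) ↔ Even (e₀ k))) ↔
          ∀ k ∈ T, (Even (e k) ↔ Even (e₀ k)) := by
        simp only [T, Finset.mem_filter, Finset.mem_univ, true_and, mapDomain_swap_apply]
        constructor
        · intro hk k hkK
          have := hk (Equiv.swap i j k) (by rwa [hF])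
          rwa [Equiv.swap_apply_self, ← hpar₀ k _ hkK (hF k).symm] at this
        · intro hk k hkK
          have := hk (Equiv.swap i j k) (by rwa [hF])
          rwa [← hpar₀ k _ hkK (hF k).symm] at this
      by_cases hT : ∀ k ∈ T, (Even (e k) ↔ Even (e₀ k))
      · rw [if_pos hT, if_pos (hiff.2 hT)]
      · rw [if_neg hT, if_neg (mt hiff.1 hT), neg_zero]
    · have hK : F₂ i = K := by
        by_contra hK
        have := h.le i
        have := h.of_lt i
        have := h.of_eq i
        have hty := h.ty_S i
        have hty' := h.ty_D i
        rw [hi] at hty hty'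
        obtain h1 | h1 : F₂ i < K ∨ F₂ i = K + 1 := by omega
        · cases hty h1
        · cases hty' h1
      rw [← Nat.not_even_iff_odd, hpar e he i hK.ge, Nat.not_even_iff_odd]
      exact h.odd i hK
    · have hK : ∀ i, ty i = BTy.D → F₂ i = K + 1 := fun i hi => by
        by_contra hK
        have := h.le i
        have := h.of_lt i
        have := h.of_eq i
        have hty := h.ty_S i
        have hty' := h.ty_B i
        rw [hi] at hty hty'
        obtain h1 | h1 : F₂ i < K ∨ F₂ i = K := by omega
        · cases hty h1
        · cases hty' h1
      have heven : ∀ i, ty i = BTy.D → Even (e i) := fun i hi =>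
        (hpar e he i (by have := hK i hi; omega)).2 (h.even i (hK i hi))
      exact (heven i hi).add (heven j hj)
  refine isJInd_iff_of_isLowest
    (isLowest_blkSub hm₁ (hc₁.trans_ne one_ne_zero) fun d g hg e he => h.minimal₁ hg he)
    (isLowest_blkSub hm₂ (hc₂.trans_ne one_ne_zero) fun d g hg e he => h.minimal₂ hg he)
    (fun U hU => ?_) χ
  obtain ⟨f', hf', hc'⟩ := exists_parity_mem U hU e₀ T
  convert hf'
  refine Subtype.ext ?_
  ext e
  rw [hf₂, hc']

end Adapted

section BlockStructure

variable {n : ℕ}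

/-- The position of `i` within its block. -/
def blockRank (F : Fin n → ℕ) (i : Fin n) : ℕ := (Finset.univ.filter fun j => j < i ∧ F j = F i).card

lemma blockRank_lt (F : Fin n → ℕ) (i : Fin n) :
    blockRank F i < (Finset.univ.filter fun j => F j = F i).card := by
  refine Finset.card_lt_card (Finset.ssubset_iff_of_subset ?_ |>.2 ⟨i, by simp, by simp⟩)
  exact Finset.monotone_filter_right _ fun j _ h => h.2

lemma blockRank_lt_blockRank {F : Fin n → ℕ} {i j : Fin n} (hF : F i = F j) (h : i < j) :
    blockRank F i < blockRank F j := by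
  refine Finset.card_lt_card (Finset.ssubset_iff_of_subset ?_ |>.2 ⟨i, by simp [h, hF], by simp⟩)
  exact Finset.monotone_filter_right _ fun k _ hk => ⟨hk.1.trans h, hk.2.trans hF⟩

lemma blockRank_injOn {F : Fin n → ℕ} {i j : Fin n} (hF : F i = F j)
    (h : blockRank F i = blockRank F j) : i = j := by
  rcases lt_trichotomy i j with hij | hij | hij
  · exact absurd h (blockRank_lt_blockRank hF hij).ne
  · exact hij
  · exact absurd h (blockRank_lt_blockRank hF.symm hij).ne'

lemma exists_blockRank_eq (F : Fin n → ℕ) {b v : ℕ}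
    (hv : v < (Finset.univ.filter fun j => F j = b).card) : ∃ j, F j = b ∧ blockRank F j = v := by
  have : (Finset.univ.filter fun j => F j = b).image (blockRank F) =
      Finset.range (Finset.univ.filter fun j => F j = b).card := by
    refine Finset.eq_of_subset_of_card_le ?_ ?_
    · intro x hx
      obtain ⟨i, hi, rfl⟩ := Finset.mem_image.1 hx
      obtain rfl := (Finset.mem_filter.1 hi).2
      exact Finset.mem_range.2 (blockRank_lt F i)
    · rw [Finset.card_range, Finset.card_image_of_injOn]
      intro i hi j hj hij
      exact blockRank_injOn ((Finset.mem_filter.1 hi).2.trans (Finset.mem_filter.1 hj).2.symm) hij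
  obtain ⟨j, hj, hj'⟩ := Finset.mem_image.1 (this ▸ Finset.mem_range.2 hv)
  exact ⟨j, (Finset.mem_filter.1 hj).2, hj'⟩

lemma exists_adapted {F₁ F₂ : Fin n → ℕ} {ty : Fin n → BTy} {K a b : ℕ} (le : ∀ i, F₁ i ≤ K)
    (of_lt : ∀ i, F₁ i < K → F₂ i = F₁ i) (of_eq : ∀ i, F₁ i = K → F₂ i = K ∨ F₂ i = K + 1)
    (ty_S : ∀ i, F₂ i < K → ty i = BTy.S) (ty_B : ∀ i, F₂ i = K → ty i = BTy.B)
    (ty_D : ∀ i, F₂ i = K + 1 → ty i = BTy.D)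
    (ha : (Finset.univ.filter fun i => F₂ i = K).card = a)
    (hb : (Finset.univ.filter fun i => F₂ i = K + 1).card = b) (hab : b = a ∨ b = a + 1) :
    ∃ e₀, Adapted F₁ F₂ ty K e₀ := by
  let e₀ : Fin n →₀ ℕ := Finsupp.equivFunOnFinite.symm fun i =>
    if F₂ i < K then blockRank F₂ i else if F₂ i = K then 2 * blockRank F₂ i + 1
    else 2 * blockRank F₂ i
  have eS : ∀ i, F₂ i < K → e₀ i = blockRank F₂ i := fun i hi => if_pos hi
  have eB : ∀ i, F₂ i = K → e₀ i = 2 * blockRank F₂ i + 1 := fun i hi =>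
    (if_neg hi.not_lt).trans (if_pos hi)
  have eD : ∀ i, F₂ i = K + 1 → e₀ i = 2 * blockRank F₂ i := fun i hi =>
    (if_neg (by omega)).trans (if_neg (by omega))
  have rB : ∀ i, F₂ i = K → blockRank F₂ i < a := fun i hi => by
    have := blockRank_lt F₂ i
    rwa [hi, ha] at this
  have rD : ∀ i, F₂ i = K + 1 → blockRank F₂ i < b := fun i hi => by
    have := blockRank_lt F₂ i
    rwa [hi, hb] at this
  have hlt : ∀ i, F₁ i < K ∨ F₁ i = K := fun i => (le i).lt_or_eq
  refine ⟨e₀, le, of_lt, of_eq, ty_S, ty_B, ty_D, fun i j hF he => ?_, fun i hi => ?_,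
    fun i hi => ?_, fun c => ?_⟩
  · rcases hlt i with hi | hi
    · have hj : F₁ j < K := hF ▸ hi
      have h1 := of_lt i hi
      have h2 := of_lt j hj
      rw [eS i (by omega), eS j (by omega)] at he
      exact blockRank_injOn (by omega) he
    · have hj : F₁ j = K := hF ▸ hi
      rcases of_eq i hi with h1 | h1 <;> rcases of_eq j hj with h2 | h2
      · rw [eB i h1, eB j h2] at he
        exact blockRank_injOn (h1.trans h2.symm) (by omega)
      · rw [eB i h1, eD j h2] at he
        omega
      · rw [eD i h1, eB j h2] at he
        omega
      · rw [eD i h1, eD j h2] at he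
        exact blockRank_injOn (h1.trans h2.symm) (by omega)
  · rw [eB i hi]
    exact odd_two_mul_add_one _
  · rw [eD i hi]
    exact even_two_mul _
  · have hF : ∀ i, F₂ i < K → F₁ i = F₂ i := fun i hi => by
      rcases hlt i with h | h
      · exact (of_lt i h).symm
      · have := of_eq i h
        omega
    have hF' : ∀ i, F₂ i = K ∨ F₂ i = K + 1 → F₁ i = K := fun i hi => by
      rcases hlt i with h | h
      · have := of_lt i h
        omega
      · exact h
    rcases lt_trichotomy c K with hc | rfl | hc
    · refine ⟨(Finset.univ.filter fun i => F₂ i = c).card, fun i hi => ?_, fun v hv => ?_⟩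
      · have h1 := of_lt i (hi.trans_lt hc)
        rw [eS i (by omega)]
        have := blockRank_lt F₂ i
        rwa [h1, hi] at this
      · obtain ⟨j, hj, hj'⟩ := exists_blockRank_eq F₂ hv
        exact ⟨j, (hF j (by omega)).trans hj, (eS j (by omega)).trans hj'⟩
    · refine ⟨a + b, fun i hi => ?_, fun v hv => ?_⟩
      · rcases of_eq i hi with h1 | h1
        · have := rB i h1
          rw [eB i h1]
          omega
        · have := rD i h1
          rw [eD i h1]
          omega
      · obtain ⟨k, rfl | rfl⟩ := Nat.even_or_odd' v
        · obtain ⟨j, hj, hj'⟩ := exists_blockRank_eq F₂ (b := c + 1) (v := k) (by omega)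
          exact ⟨j, hF' j (Or.inr hj), by rw [eD j hj, hj']⟩
        · obtain ⟨j, hj, hj'⟩ := exists_blockRank_eq F₂ (b := c) (v := k) (by omega)
          exact ⟨j, hF' j (Or.inl hj), by rw [eB j hj, hj']⟩
    · exact ⟨0, fun i hi => absurd (le i) (by omega), fun v hv => absurd hv (Nat.not_lt_zero v)⟩

lemma lt_blockOf_iff {N : ℕ} {c : ℕ → ℕ} {i b : ℕ} (hb : b < N) :
    b < blockOf N c i ↔ ∑ b' ∈ Finset.range (b + 1), c b' ≤ i := by
  have hmono : ∀ {x y : ℕ}, x ≤ y →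
      ∑ b' ∈ Finset.range x, c b' ≤ ∑ b' ∈ Finset.range y, c b' := fun h =>
    Finset.sum_le_sum_of_subset (Finset.range_mono h)
  constructor
  · intro h
    by_contra hlt
    refine absurd (Finset.card_le_card (t := Finset.range b) fun x hx => ?_) (by simpa [blockOf] using h)
    have := (Finset.mem_filter.1 hx).2
    rw [Finset.mem_range]
    by_contra! hx'
    exact hlt ((hmono (by omega)).trans this)
  · intro h
    have : Finset.range (b + 1) ⊆ (Finset.range N).filter
        fun b => ∑ b' ∈ Finset.range (b + 1), c b' ≤ i := fun x hx => by
      rw [Finset.mem_range] at hx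
      exact Finset.mem_filter.2 ⟨Finset.mem_range.2 (by omega), (hmono (by omega)).trans h⟩
    simpa [blockOf] using Finset.card_le_card this

lemma blockOf_eq_iff {N : ℕ} {c : ℕ → ℕ} {i b : ℕ} (hb : b < N) :
    blockOf N c i = b ↔
      ∑ b' ∈ Finset.range b, c b' ≤ i ∧ i < ∑ b' ∈ Finset.range (b + 1), c b' := by
  have h1 := lt_blockOf_iff (c := c) (i := i) hb
  rcases b with _ | b
  · rw [Finset.sum_range_zero]
    omega
  · have h2 := lt_blockOf_iff (c := c) (i := i) (Nat.lt_of_succ_lt hb)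
    omega

lemma card_blockOf_eq {N : ℕ} {c : ℕ → ℕ} {b : ℕ} (hb : b < N)
    (h : ∑ b' ∈ Finset.range (b + 1), c b' ≤ n) :
    (Finset.univ.filter fun i : Fin n => blockOf N c i = b).card = c b := by
  have : (Finset.univ.filter fun i : Fin n => blockOf N c i = b).map Fin.valEmbedding =
      Finset.Ico (∑ b' ∈ Finset.range b, c b') (∑ b' ∈ Finset.range (b + 1), c b') := by
    ext x
    simp only [Finset.mem_map, Finset.mem_filter, Finset.mem_univ, true_and, blockOf_eq_iff hb,
      Fin.valEmbedding_apply, Finset.mem_Ico]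
    exact ⟨fun ⟨i, hi, hix⟩ => hix ▸ hi, fun hx => ⟨⟨x, by omega⟩, hx, rfl⟩⟩
  rw [← Finset.card_map Fin.valEmbedding, this, Nat.card_Ico, Finset.sum_range_succ]
  omega

/-- The parts of the conjugate partition add up to the same size. -/
lemma sum_conjugate {σ k : ℕ} (p : Fin σ → ℕ) (hp : ∀ t, p t ≤ k) :
    ∑ b ∈ Finset.range k, (Finset.univ.filter fun t => k - b ≤ p t).card = ∑ t, p t := by
  rw [← Finset.sum_range_reflect]
  have : ∀ j ∈ Finset.range k, (Finset.univ.filter fun t => k - (k - 1 - j) ≤ p t).card =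
      ∑ t, if j < p t then 1 else 0 := fun j hj => by
    rw [Finset.mem_range] at hj
    rw [Finset.card_filter]
    refine Finset.sum_congr rfl fun t _ => if_congr ?_ rfl rfl
    omega
  rw [Finset.sum_congr rfl this, Finset.sum_comm]
  refine Finset.sum_congr rfl fun t _ => ?_
  rw [← Finset.card_filter, show (Finset.range k).filter (· < p t) = Finset.range (p t) by
    ext x
    have := hp t
    simp only [Finset.mem_filter, Finset.mem_range]
    omega, Finset.card_range]

end BlockStructure

/-- 3.2(h), 3.6: for a partition `p₁ ≥ … ≥ p_σ ≥ 1` of `n` with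
conjugate `p̄`, `k = p₁`, and `p̄₁ = a + b` with `b - a ∈ {0,1}`, the `j`-induction
`j_{S_{p̄ₖ} × … × S_{p̄₂} × S_{p̄₁}}^{W_n}(sgn)` and the `j`-induction
`j_{S_{p̄ₖ} × … × S_{p̄₂} × W_a × W'_b}^{W_n}(sgn)` produce the same irreducible
representation of `W_n`. -/
theorem stmt16 (σ n kk aa bb : ℕ) (hσ : 0 < σ) (p : Fin σ → ℕ)
    (hmono : Antitone p) (hp1 : ∀ t, 1 ≤ p t) (hsum : ∑ t, p t = n)
    (hkk : kk = p ⟨0, hσ⟩)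
    (pbar : ℕ → ℕ)
    (hpbar : ∀ i, pbar i = (Finset.univ.filter (fun t : Fin σ => i ≤ p t)).card)
    (hab : aa + bb = pbar 1) (hba : bb = aa ∨ bb = aa + 1) :
    ∀ χ : (BWn n) → ℂ,
      IsJInd (reflChar (n := n))
        (blkSub n (fun i => blockOf kk (fun b => pbar (kk - b)) (i : ℕ))
          (fun _ => BTy.S))
        (BWn n) (resChar _ sgnChar) χ ↔
      IsJInd (reflChar (n := n))
        (blkSub n
          (fun i => blockOf (kk + 1)
            (fun b => if b + 2 ≤ kk then pbar (kk - b)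
              else if b + 1 = kk then aa else bb) (i : ℕ))
          (fun i =>
            if blockOf (kk + 1)
                (fun b => if b + 2 ≤ kk then pbar (kk - b)
                  else if b + 1 = kk then aa else bb) (i : ℕ) + 2 ≤ kk
            then BTy.S
            else if blockOf (kk + 1)
                (fun b => if b + 2 ≤ kk then pbar (kk - b)
                  else if b + 1 = kk then aa else bb) (i : ℕ) + 1 = kk
            then BTy.B else BTy.D))
        (BWn n) (resChar _ sgnChar) χ := by
  intro χ
  have hle : ∀ t, p t ≤ kk := fun t => hkk ▸ hmono (Fin.mk_le_mk.2 (Nat.zero_le t))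
  have htot : ∑ b ∈ Finset.range kk, pbar (kk - b) = n := by
    simp_rw [hpbar]
    rw [sum_conjugate p hle, hsum]
  obtain ⟨K, rfl⟩ : ∃ K, kk = K + 1 := ⟨kk - 1, by have := hp1 ⟨0, hσ⟩; omega⟩
  set c₁ : ℕ → ℕ := fun b => pbar (K + 1 - b) with hc₁
  set c₂ : ℕ → ℕ := fun b => if b + 2 ≤ K + 1 then pbar (K + 1 - b)
    else if b + 1 = K + 1 then aa else bb with hc₂
  have hS : ∀ b ≤ K, ∑ x ∈ Finset.range b, c₂ x = ∑ x ∈ Finset.range b, c₁ x := fun b hb =>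
    Finset.sum_congr rfl fun x hx => if_pos (by rw [Finset.mem_range] at hx; omega)
  have hcK : c₂ K = aa := by simp [hc₂]
  have hcK' : c₂ (K + 1) = bb := by simp [hc₂]
  have hS₁ : ∑ x ∈ Finset.range K, c₁ x + (aa + bb) = n := by
    rw [← htot, Finset.sum_range_succ, Nat.add_sub_cancel_left, hab]
  have hS₂ : ∑ x ∈ Finset.range (K + 1), c₂ x = ∑ x ∈ Finset.range K, c₁ x + aa := by
    rw [Finset.sum_range_succ, hS K le_rfl, hcK]
  have hS₃ : ∑ x ∈ Finset.range (K + 1 + 1), c₂ x = n := by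
    rw [Finset.sum_range_succ, hS₂, hcK', add_assoc, hS₁]
  have hlt : ∀ (i : Fin n), ∀ b < K,
      (b < blockOf (K + 1 + 1) c₂ i ↔ b < blockOf (K + 1) c₁ i) := fun i b hb => by
    rw [lt_blockOf_iff (by omega), lt_blockOf_iff (by omega), hS (b + 1) hb]
  have hle₁ : ∀ i : Fin n, blockOf (K + 1) c₁ i ≤ K := fun i => by
    have := lt_blockOf_iff (N := K + 1) (c := c₁) (i := i) (lt_add_one K)
    have hi := i.2
    rw [htot] at this
    omega
  have hle₂ : ∀ i : Fin n, blockOf (K + 1 + 1) c₂ i ≤ K + 1 := fun i => by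
    have := lt_blockOf_iff (N := K + 1 + 1) (c := c₂) (i := i) (lt_add_one (K + 1))
    have hi := i.2
    rw [hS₃] at this
    omega
  have hex := exists_adapted (n := n) (F₁ := fun i => blockOf (K + 1) c₁ i)
    (F₂ := fun i => blockOf (K + 1 + 1) c₂ i)
    (ty := fun i => if blockOf (K + 1 + 1) c₂ i + 2 ≤ K + 1 then BTy.S
      else if blockOf (K + 1 + 1) c₂ i + 1 = K + 1 then BTy.B else BTy.D)
    (K := K) (a := aa) (b := bb) hle₁ ?_ ?_ ?_ ?_ ?_ ?_ ?_ hba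
  · obtain ⟨e₀, he₀⟩ := hex
    exact he₀.isJInd_iff χ
  · intro i hi
    have h1 := hlt i (blockOf (K + 1) c₁ i) hi
    have h2 := hlt i (blockOf (K + 1) c₁ i - 1)
    omega
  · intro i hi
    have h1 := hlt i (K - 1)
    have h2 := hle₂ i
    omega
  · intro i hi
    exact if_pos (by omega)
  · intro i hi
    exact (if_neg (by omega)).trans (if_pos (by omega))
  · intro i hi
    exact (if_neg (by omega)).trans (if_neg (by omega))
  · rw [card_blockOf_eq (by omega) (by omega), hcK]
  · rw [card_blockOf_eq (by omega) (by omega), hcK']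

end
end CS
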